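/- Set M = ⟨2⟩ ⊥ U ⊥ E8(−1), an even lattice of rank 11, signature (2, 9) and discriminant −2, whose discriminant group A(M) is cyclic of order 2. Every even lattice L of signature (2, 9) for which there exists a group isomorphism A(L) → A(M) preserving the discriminant quadratic forms is isometric to M. -/

import Mathlib

open Matrix

/-- The Gram (Coxeter) matrix of the root lattice `E₈`. -/
def E8M : Matrix (Fin 8) (Fin 8) ℤ :=
  !![2, 0, -1, 0, 0, 0, 0, 0;
     0, 2, 0, -1, 0, 0, 0, 0;
     -1, 0, 2, -1, 0, 0, 0, 0;
     0, -1, -1, 2, -1, 0, 0, 0;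
     0, 0, 0, -1, 2, -1, 0, 0;
     0, 0, 0, 0, -1, 2, -1, 0;
     0, 0, 0, 0, 0, -1, 2, -1;
     0, 0, 0, 0, 0, 0, -1, 2]

/-- The Gram matrix of the hyperbolic plane `U`. -/
def UM : Matrix (Fin 2) (Fin 2) ℤ := !![0, 1; 1, 0]

/-- Gram matrix of the orthogonal direct sum of two lattices given by Gram matrices. -/
def dsum {m k : ℕ} (A : Matrix (Fin m) (Fin m) ℤ) (B : Matrix (Fin k) (Fin k) ℤ) :
    Matrix (Fin (m + k)) (Fin (m + k)) ℤ :=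
  Matrix.reindex finSumFinEquiv finSumFinEquiv (Matrix.fromBlocks A 0 0 B)

/-- The Gram matrix of `M = ⟨2⟩ ⊥ U ⊥ E₈(−1)`. -/
def M12 : Matrix (Fin 11) (Fin 11) ℤ := dsum (dsum !![2] UM) (-E8M)

/-- Componentwise coercion `ℤⁿ → ℚⁿ`. -/
def ratify {n : ℕ} (x : Fin n → ℤ) : Fin n → ℚ := fun i => (x i : ℚ)

/-- The discriminant group `A(L) = L*/L` of the lattice `ℤⁿ` with Gram matrix `G`,
presented as the cokernel `ℤⁿ/G·ℤⁿ` (multiplication by `G` identifies `L*/L` with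
this cokernel when `det G ≠ 0`). -/
def DiscGroup {n : ℕ} (G : Matrix (Fin n) (Fin n) ℤ) :=
  (Fin n → ℤ) ⧸ LinearMap.range (Matrix.mulVecLin G)

instance {n : ℕ} (G : Matrix (Fin n) (Fin n) ℤ) : AddCommGroup (DiscGroup G) :=
  inferInstanceAs (AddCommGroup ((Fin n → ℤ) ⧸ LinearMap.range (Matrix.mulVecLin G)))

instance {n : ℕ} (G : Matrix (Fin n) (Fin n) ℤ) : Module ℤ (DiscGroup G) :=
  inferInstanceAs (Module ℤ ((Fin n → ℤ) ⧸ LinearMap.range (Matrix.mulVecLin G)))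

/-- The class of `u ∈ ℤⁿ` in the discriminant group. -/
def discMk {n : ℕ} (G : Matrix (Fin n) (Fin n) ℤ) (u : Fin n → ℤ) : DiscGroup G :=
  Submodule.Quotient.mk u

/-- The discriminant quadratic form `q_L : A(L) → ℚ/2ℤ` in the cokernel presentation. -/
noncomputable def discQuad {n : ℕ} (G : Matrix (Fin n) (Fin n) ℤ) (u : Fin n → ℤ) :
    AddCircle (2 : ℚ) :=
  ((ratify u ⬝ᵥ ((G.map (Int.cast : ℤ → ℚ))⁻¹).mulVec (ratify u) : ℚ) : AddCircle (2 : ℚ))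

/-- `G` has signature `(p, q)`: over `ℝ` the form is congruent to a diagonal form with
`p` entries `+1` and `q` entries `−1`. -/
def HasSignature {n : ℕ} (G : Matrix (Fin n) (Fin n) ℤ) (p q : ℕ) : Prop :=
  ∃ (P : Matrix (Fin n) (Fin n) ℝ) (d : Fin n → ℝ), IsUnit P.det ∧
    (∀ i, d i = 1 ∨ d i = -1) ∧
    (Finset.univ.filter fun i => d i = 1).card = p ∧
    (Finset.univ.filter fun i => d i = -1).card = q ∧
    P.transpose * (G.map (Int.cast : ℤ → ℝ)) * P = Matrix.diagonal d

open Module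

section Gram

variable {V R : Type*} [AddCommGroup V] [CommRing R]

/-- The Gram matrix of a family of vectors with respect to a bilinear form. -/
def gramMatrix {ι : Type*} (B : V →ₗ[ℤ] V →ₗ[ℤ] R) (b : ι → V) : Matrix ι ι R :=
  Matrix.of fun i j => B (b i) (b j)

theorem det_gram_basis {ι κ : Type*} [Fintype ι] [DecidableEq ι] [Fintype κ] [DecidableEq κ]
    (B : V →ₗ[ℤ] V →ₗ[ℤ] R) (b : Basis ι ℤ V) (c : Basis κ ℤ V) :
    (gramMatrix B c).det = (gramMatrix B b).det := by
  have key : ∀ c : Basis ι ℤ V, (gramMatrix B c).det = (gramMatrix B b).det := by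
    intro c
    set P := b.toMatrix c with hP
    have h1 : gramMatrix B c = (P.map (Int.cast : ℤ → R)).transpose * gramMatrix B b
        * P.map (Int.cast : ℤ → R) := by
      ext i j
      have hi := b.sum_toMatrix_smul_self c i
      have hj := b.sum_toMatrix_smul_self c j
      simp only [gramMatrix, Matrix.of_apply, Matrix.mul_apply, Matrix.transpose_apply,
        Matrix.map_apply]
      rw [← hi, ← hj]
      simp only [map_sum, map_smul, LinearMap.sum_apply, LinearMap.smul_apply, zsmul_eq_mul,
        Finset.mul_sum, Finset.sum_mul]
      refine Finset.sum_congr rfl fun x _ => Finset.sum_congr rfl fun y _ => ?_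
      rw [← hP]; ring
    have h2 : P.det * P.det = 1 := by
      have h3 : P * c.toMatrix b = 1 := b.toMatrix_mul_toMatrix_flip c
      have h4 : IsUnit P.det := IsUnit.of_mul_eq_one _
        (by rw [← Matrix.det_mul, h3, Matrix.det_one])
      rcases Int.isUnit_iff.1 h4 with h | h <;> rw [h] <;> norm_num
    have h5 : (P.map (Int.cast : ℤ → R)).det = ((P.det : ℤ) : R) := (Int.cast_det P).symm
    rw [h1, Matrix.det_mul, Matrix.det_mul, Matrix.det_transpose, h5]
    calc _ = ((P.det * P.det : ℤ) : R) * (gramMatrix B b).det := by push_cast; ring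
      _ = _ := by rw [h2]; simp
  rw [← key (c.reindex (c.indexEquiv b))]
  have : gramMatrix B (c.reindex (c.indexEquiv b))
      = Matrix.reindex (c.indexEquiv b) (c.indexEquiv b) (gramMatrix B c) := by
    ext i j; simp [gramMatrix]
  rw [this, Matrix.det_reindex_self]

end Gram

section Primitive

variable {V : Type*} [AddCommGroup V]

theorem exists_primitive [Module.Free ℤ V] [Module.Finite ℤ V] {x : V} (hx : x ≠ 0) :
    ∃ (g : ℤ) (z : V) (f : V →ₗ[ℤ] ℤ), x = g • z ∧ f z = 1 := by
  let b := Module.Free.chooseBasis ℤ V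
  let ev : (V →ₗ[ℤ] ℤ) →ₗ[ℤ] ℤ := LinearMap.applyₗ x
  obtain ⟨g, hg⟩ := (IsPrincipalIdealRing.principal (LinearMap.range ev)).principal
  have hd : ∀ f : V →ₗ[ℤ] ℤ, g ∣ f x := by
    intro f
    have : f x ∈ Submodule.span ℤ {g} := by rw [← hg]; exact ⟨f, rfl⟩
    exact Ideal.mem_span_singleton.1 this
  have hmem : g ∈ LinearMap.range ev := by rw [hg]; exact Submodule.mem_span_singleton_self g
  obtain ⟨f, hf⟩ := hmem
  choose c hc using fun i => hd (b.coord i)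
  have hxz : x = g • ∑ i, c i • b i := by
    rw [Finset.smul_sum]
    conv_lhs => rw [← b.sum_repr x]
    refine Finset.sum_congr rfl fun i _ => ?_
    rw [smul_smul, ← hc i]; rfl
  refine ⟨g, ∑ i, c i • b i, f, hxz, ?_⟩
  have h1 : f x = g := hf
  have hg0 : g ≠ 0 := by
    rintro rfl
    exact hx (by rw [hxz, zero_smul])
  rw [hxz, map_smul, smul_eq_mul] at h1
  exact mul_left_cancel₀ hg0 (by rw [h1, mul_one])

/-- A basis of `V` made of `z` and a basis of `ker f`, where `f z = 1`. -/
noncomputable def consBasis {n : ℕ} (f : V →ₗ[ℤ] ℤ) (z : V) (hz : f z = 1)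
    (b : Basis (Fin n) ℤ (LinearMap.ker f)) : Basis (Fin (n + 1)) ℤ V :=
  Basis.mkFinCons z b
    (by
      intro c x hx h
      have := congrArg f h
      simpa [hz, LinearMap.mem_ker.1 hx] using this)
    (by
      intro x
      exact ⟨-(f x), by simp [LinearMap.mem_ker, hz]⟩)

theorem consBasis_zero {n : ℕ} (f : V →ₗ[ℤ] ℤ) (z : V) (hz : f z = 1)
    (b : Basis (Fin n) ℤ (LinearMap.ker f)) : consBasis f z hz b 0 = z := by
  simp [consBasis]

theorem consBasis_succ {n : ℕ} (f : V →ₗ[ℤ] ℤ) (z : V) (hz : f z = 1)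
    (b : Basis (Fin n) ℤ (LinearMap.ker f)) (i : Fin n) : consBasis f z hz b i.succ = b i := by
  simp [consBasis]

theorem ker_finrank [Module.Free ℤ V] [Module.Finite ℤ V] {f : V →ₗ[ℤ] ℤ} {z : V}
    (hz : f z = 1) : finrank ℤ V = finrank ℤ (LinearMap.ker f) + 1 := by
  rw [finrank_eq_card_basis (consBasis f z hz (finBasis ℤ (LinearMap.ker f))), Fintype.card_fin]

end Primitive

theorem det_gram_schur {n : ℕ} (H : Matrix (Fin (n + 1)) (Fin (n + 1)) ℚ) (h0 : H 0 0 ≠ 0) :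
    H.det = H 0 0 * (Matrix.of fun i j : Fin n =>
      H i.succ j.succ - H i.succ 0 * H 0 j.succ / H 0 0).det := by
  have h1 : H.det = (Matrix.of (Fin.cons (H 0) fun (i : Fin n) (j : Fin (n + 1)) =>
      H i.succ j - H i.succ 0 / H 0 0 * H 0 j) : Matrix _ _ ℚ).det := by
    refine Matrix.det_eq_of_forall_row_eq_smul_add_const
      (Fin.cons 0 fun i : Fin n => H i.succ 0 / H 0 0) 0 rfl ?_
    intro i j
    refine Fin.cases ?_ (fun i => ?_) i <;> simp
  rw [h1, Matrix.det_succ_column_zero, Fin.sum_univ_succ, Finset.sum_eq_zero]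
  · simp only [Fin.val_zero, pow_zero, one_mul, Matrix.of_apply, Fin.cons_zero, add_zero]
    congr 2
    ext i j
    simp [Matrix.submatrix_apply]
    ring
  · intro i _
    simp [h0]

theorem exists_minimal_vector {V : Type*} [AddCommGroup V] [Module.Free ℤ V] [Module.Finite ℤ V]
    [Nontrivial V] (B : V →ₗ[ℤ] V →ₗ[ℤ] ℚ) :
    ∃ v : V, v ≠ 0 ∧ ∀ x : V, x ≠ 0 → |B v v| ≤ |B x x| := by
  let b := Module.Free.chooseBasis ℤ V
  have hN : ∃ N : ℕ, 0 < N ∧ ∀ i j, ∃ k : ℤ, (N : ℚ) * B (b i) (b j) = k := by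
    refine ⟨∏ i, ∏ j, (B (b i) (b j)).den,
      Finset.prod_pos fun i _ => Finset.prod_pos fun j _ => (B (b i) (b j)).den_pos, ?_⟩
    intro i j
    have h1 : (B (b i) (b j)).den ∣ ∏ i, ∏ j, (B (b i) (b j)).den :=
      (Finset.dvd_prod_of_mem (fun j => (B (b i) (b j)).den) (Finset.mem_univ j)).trans
        (Finset.dvd_prod_of_mem (fun i => ∏ j, (B (b i) (b j)).den) (Finset.mem_univ i))
    obtain ⟨m, hm⟩ := h1
    refine ⟨m * (B (b i) (b j)).num, ?_⟩
    rw [hm]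
    push_cast
    have := Rat.mul_den_eq_num (B (b i) (b j))
    linear_combination (m : ℚ) * this
  obtain ⟨N, hN0, hN⟩ := hN
  choose k hk using hN
  have hint : ∀ x : V, ∃ t : ℕ, (N : ℚ) * |B x x| = t := by
    intro x
    refine ⟨(∑ i, ∑ j, b.repr x i * b.repr x j * k i j).natAbs, ?_⟩
    have : (N : ℚ) * B x x = ((∑ i, ∑ j, b.repr x i * b.repr x j * k i j : ℤ) : ℚ) := by
      conv_lhs => rw [← b.sum_repr x]
      simp only [map_sum, map_smul, LinearMap.sum_apply, LinearMap.smul_apply, zsmul_eq_mul,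
        Finset.mul_sum]
      push_cast
      rw [Finset.sum_comm]
      refine Finset.sum_congr rfl fun i _ => Finset.sum_congr rfl fun j _ => ?_
      rw [← hk]; ring
    rw [Nat.cast_natAbs, Int.cast_abs, ← this, abs_mul, Nat.abs_cast]
  choose t ht using hint
  obtain ⟨y, hy⟩ := exists_ne (0 : V)
  obtain ⟨v, hv, hmin⟩ := WellFounded.has_min (measure t).wf {x : V | x ≠ 0} ⟨y, hy⟩
  refine ⟨v, hv, fun x hx => ?_⟩
  have h1 : t v ≤ t x := not_lt.1 (hmin x hx)
  have h2 : (N : ℚ) * |B v v| ≤ N * |B x x| := by rw [ht, ht]; exact_mod_cast h1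
  exact le_of_mul_le_mul_left h2 (by exact_mod_cast hN0)

/-- Hermite's bound for the minimum of an anisotropic, not necessarily definite, form. -/
theorem hermite_bound (n : ℕ) : ∀ (V : Type) [AddCommGroup V] [Module.Free ℤ V]
    [Module.Finite ℤ V] (B : V →ₗ[ℤ] V →ₗ[ℤ] ℚ) (b : Basis (Fin (n + 1)) ℤ V)
    (_ : ∀ x y, B x y = B y x) (_ : ∀ x, B x x = 0 → x = 0),
    ∃ v : V, v ≠ 0 ∧ |B v v| ^ (n + 1) * 3 ^ ((n + 1) * n / 2)
      ≤ 4 ^ ((n + 1) * n / 2) * |(gramMatrix B b).det| := by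
  induction n with
  | zero =>
    intro V _ _ _ B b _ _
    refine ⟨b 0, b.ne_zero 0, ?_⟩
    simp [gramMatrix]
  | succ n ih =>
    intro V _ _ _ B b hs ha
    have : Nontrivial V := ⟨b 0, 0, b.ne_zero 0⟩
    obtain ⟨v, hv0, hmin⟩ := exists_minimal_vector B
    obtain ⟨g, z, f, hvz, hfz⟩ := exists_primitive hv0
    have hz0 : z ≠ 0 := by rintro rfl; simp at hfz
    set a := B z z with ha_def
    have ha0 : a ≠ 0 := fun h => hz0 (ha z h)
    have hminz : ∀ x : V, x ≠ 0 → |a| ≤ |B x x| := by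
      intro x hx
      refine le_trans ?_ (hmin x hx)
      have hg0 : g ≠ 0 := by rintro rfl; exact hv0 (by simpa using hvz)
      have : B v v = (g : ℚ) ^ 2 * a := by
        rw [hvz]; simp only [map_smul, LinearMap.smul_apply, zsmul_eq_mul]; ring
      rw [this, abs_mul]
      have h1 : (1 : ℚ) ≤ |(g : ℚ) ^ 2| := by
        rw [abs_of_nonneg (sq_nonneg _)]
        have : 1 ≤ g ^ 2 := by have := sq_pos_of_ne_zero hg0; omega
        exact_mod_cast this
      nlinarith [abs_nonneg a]
    have hrank : finrank ℤ (LinearMap.ker f) = n + 1 := by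
      have h1 := ker_finrank hfz
      have h2 : finrank ℤ V = n + 2 := by rw [finrank_eq_card_basis b]; simp
      omega
    let K := LinearMap.ker f
    let c : Basis (Fin (n + 1)) ℤ K := finBasisOfFinrankEq ℤ _ hrank
    let S : K →ₗ[ℤ] K →ₗ[ℤ] ℚ := LinearMap.mk₂ ℤ
      (fun x y => B x y - B x z * B z y / a)
      (fun x x' y => by simp; ring)
      (fun t x y => by simp; ring)
      (fun x y y' => by simp; ring)
      (fun t x y => by simp; ring)
    have hS : ∀ x y, S x y = B x y - B x z * B z y / a := fun x y => rfl
    obtain ⟨y, hy0, hy⟩ := ih K S c (by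
      intro x y; rw [hS, hS, hs x y, hs x z, hs z y]; ring) (by
      intro x hx
      set q : ℚ := B x z / a with hq
      have h1 : B ((q.den : ℤ) • (x : V) - q.num • z) ((q.den : ℤ) • (x : V) - q.num • z) = 0 := by
        have h2 : (q.num : ℚ) = q * q.den := (Rat.mul_den_eq_num q).symm
        have h3 : B x x = B x z * B x z / a := by
          have := hx; rw [hS, hs z x] at this; linarith
        simp only [map_sub, map_smul, LinearMap.sub_apply, LinearMap.smul_apply, zsmul_eq_mul]
        rw [hs z x, h3, ← ha_def, h2, hq]
        push_cast
        field_simp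
        ring
      have h2 := ha _ h1
      have h3 := congrArg f h2
      rw [map_sub, map_smul, map_smul, LinearMap.mem_ker.1 x.2, hfz] at h3
      have h4 : q.num = 0 := by simpa using h3
      rw [h4, zero_smul, sub_zero] at h2
      have h5 : (x : V) = 0 := (smul_eq_zero.1 h2).resolve_left (by exact_mod_cast q.den_ne_zero)
      exact Subtype.ext h5)
    refine ⟨z, hz0, ?_⟩
    have hdet : (gramMatrix B b).det = a * (gramMatrix S c).det := by
      rw [det_gram_basis B (consBasis f z hfz c) b, det_gram_schur]
      · simp only [gramMatrix, Matrix.of_apply, consBasis_zero, consBasis_succ]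
        rfl
      · simpa [gramMatrix, consBasis_zero] using ha0
    set s := S y y with hs_def
    have hs34 : 3 * |a| ≤ 4 * |s| := by
      set β : ℚ := B y z / a with hβ
      have hx0 : (y : V) - round β • z ≠ 0 := by
        intro h
        have h1 := congrArg f h
        rw [map_sub, map_smul, LinearMap.mem_ker.1 y.2, hfz] at h1
        have h2 : round β = 0 := by simpa using h1
        rw [h2, zero_smul, sub_zero] at h
        exact hy0 (Subtype.ext h)
      have h1 := hminz _ hx0
      have h2 : B ((y : V) - round β • z) ((y : V) - round β • z)
          = s + (β - round β) ^ 2 * a := by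
        rw [hs_def, hS]
        simp only [map_sub, map_smul, LinearMap.sub_apply, LinearMap.smul_apply, zsmul_eq_mul]
        rw [hs z y, ← ha_def, hβ]
        field_simp
        ring
      rw [h2] at h1
      have h3 : (β - round β) ^ 2 ≤ 1 / 4 := by
        have h4 := abs_sub_round β
        have h5 := abs_le.1 h4
        nlinarith
      have h4 : |s + (β - round β) ^ 2 * a| ≤ |s| + 1 / 4 * |a| := by
        refine (abs_add_le _ _).trans ?_
        rw [abs_mul, abs_of_nonneg (sq_nonneg (β - round β))]
        have := mul_le_mul_of_nonneg_right h3 (abs_nonneg a)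
        linarith
      linarith
    have hexp : (n + 1 + 1) * (n + 1) / 2 = (n + 1) + (n + 1) * n / 2 := by
      have : (n + 1 + 1) * (n + 1) = (n + 1) * n + (n + 1) * 2 := by ring
      rw [this, Nat.add_mul_div_right _ _ (by norm_num)]; ring
    rw [hexp, hdet, abs_mul]
    have h6 : (3 * |a|) ^ (n + 1) ≤ (4 * |s|) ^ (n + 1) :=
      pow_le_pow_left₀ (by positivity) hs34 _
    set T := (n + 1) * n / 2
    calc |a| ^ (n + 1 + 1) * 3 ^ (n + 1 + T) = |a| * (3 * |a|) ^ (n + 1) * 3 ^ T := by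
          rw [mul_pow]; ring
      _ ≤ |a| * (4 * |s|) ^ (n + 1) * 3 ^ T := by gcongr
      _ = |a| * 4 ^ (n + 1) * (|s| ^ (n + 1) * 3 ^ T) := by rw [mul_pow]; ring
      _ ≤ |a| * 4 ^ (n + 1) * (4 ^ T * |(gramMatrix S c).det|) := by gcongr
      _ = _ := by rw [pow_add]; ring

/-- A free `ℤ`-module of finite rank with an integral symmetric bilinear form. -/
structure IntLat where
  /-- the underlying module -/
  V : Type
  [grp : AddCommGroup V]
  [free : Module.Free ℤ V]
  [fin : Module.Finite ℤ V]
  /-- the bilinear form -/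
  B : V →ₗ[ℤ] V →ₗ[ℤ] ℤ
  symm : ∀ x y, B x y = B y x

attribute [instance] IntLat.grp IntLat.free IntLat.fin

namespace IntLat

/-- The rank of a lattice. -/
noncomputable def rank (L : IntLat) : ℕ := finrank ℤ L.V

/-- The determinant of a Gram matrix of a lattice. -/
noncomputable def disc (L : IntLat) : ℤ := (gramMatrix L.B (finBasis ℤ L.V)).det

theorem disc_eq (L : IntLat) {ι : Type*} [Fintype ι] [DecidableEq ι] (b : Basis ι ℤ L.V) :
    L.disc = (gramMatrix L.B b).det :=
  det_gram_basis L.B b _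

theorem rank_eq (L : IntLat) {ι : Type*} [Fintype ι] (b : Basis ι ℤ L.V) :
    L.rank = Fintype.card ι := finrank_eq_card_basis b

/-- Isometry of lattices. -/
def Iso (L M : IntLat) : Prop := ∃ e : L.V ≃ₗ[ℤ] M.V, ∀ x y, M.B (e x) (e y) = L.B x y

theorem Iso.refl (L : IntLat) : Iso L L := ⟨LinearEquiv.refl ℤ _, fun _ _ => rfl⟩

theorem Iso.symm {L M : IntLat} : Iso L M → Iso M L := by
  rintro ⟨e, he⟩
  exact ⟨e.symm, fun x y => by rw [← he, e.apply_symm_apply, e.apply_symm_apply]⟩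

theorem Iso.trans {L M N : IntLat} : Iso L M → Iso M N → Iso L N := by
  rintro ⟨e, he⟩ ⟨f, hf⟩
  exact ⟨e.trans f, fun x y => by simp [hf, he]⟩

theorem Iso.rank_eq {L M : IntLat} : Iso L M → L.rank = M.rank := fun ⟨e, _⟩ => e.finrank_eq

theorem Iso.disc_eq {L M : IntLat} : Iso L M → L.disc = M.disc := by
  rintro ⟨e, he⟩
  rw [M.disc_eq ((finBasis ℤ L.V).map e)]
  unfold disc
  congr 1
  ext i j
  simp [gramMatrix, he]

theorem Iso.of_embedding {L M : IntLat} (f : L.V →ₗ[ℤ] M.V) (hf : ∀ x y, M.B (f x) (f y) = L.B x y)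
    (hr : L.rank = M.rank) (hd : L.disc = M.disc) (h0 : L.disc ≠ 0) : Iso L M := by
  let b := finBasis ℤ L.V
  let c : Basis (Fin (finrank ℤ L.V)) ℤ M.V := finBasisOfFinrankEq ℤ _ hr.symm
  set P := LinearMap.toMatrix b c f with hP
  have h1 : gramMatrix L.B b = P.transpose * gramMatrix M.B c * P := by
    ext i j
    have hb : ∀ i, f (b i) = ∑ k, P k i • c k := fun i => by
      rw [← c.sum_repr (f (b i))]
      simp [hP, LinearMap.toMatrix_apply]
    simp only [gramMatrix, Matrix.of_apply, Matrix.mul_apply, Matrix.transpose_apply]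
    rw [← hf, hb i, hb j]
    simp only [map_sum, map_smul, LinearMap.sum_apply, LinearMap.smul_apply, smul_eq_mul,
        Finset.mul_sum, Finset.sum_mul]
    refine Finset.sum_congr rfl fun x _ => Finset.sum_congr rfl fun y _ => ?_
    ring
  have h2 : L.disc = P.det * M.disc * P.det := by
    rw [L.disc_eq b, M.disc_eq c, h1, Matrix.det_mul, Matrix.det_mul, Matrix.det_transpose]
  rw [← hd] at h2
  have h3 : P.det * P.det = 1 := by
    have : L.disc * (P.det * P.det) = L.disc * 1 := by linear_combination -h2
    exact mul_left_cancel₀ h0 this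
  exact ⟨LinearEquiv.ofIsUnitDet (IsUnit.of_mul_eq_one _ h3 : IsUnit P.det),
    fun x y => by simp [hf]⟩

/-- The orthogonal direct sum. -/
abbrev prod (L M : IntLat) : IntLat where
  V := L.V × M.V
  B := LinearMap.mk₂ ℤ (fun x y => L.B x.1 y.1 + M.B x.2 y.2)
      (fun x x' y => by simp; ring)
      (fun t x y => by simp; ring)
      (fun x y y' => by simp; ring)
      (fun t x y => by simp; ring)
  symm x y := by simp [L.symm x.1, M.symm x.2]

theorem prod_B (L M : IntLat) (x y : L.V × M.V) :
    (prod L M).B x y = L.B x.1 y.1 + M.B x.2 y.2 := rfl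

/-- The rank one lattice with Gram matrix `(a)`. -/
abbrev line (a : ℤ) : IntLat where
  V := ℤ
  B := LinearMap.mk₂ ℤ (fun x y => a * (x * y))
      (fun x x' y => by ring)
      (fun t x y => by simp; ring)
      (fun x y y' => by ring)
      (fun t x y => by simp; ring)
  symm x y := by simp [mul_comm x]

theorem line_B (a : ℤ) (x y : ℤ) : (line a).B x y = a * (x * y) := rfl

/-- The rank two lattice with Gram matrix `[[0, 1], [1, c]]`. -/
abbrev plane (c : ℤ) : IntLat where
  V := ℤ × ℤ
  B := LinearMap.mk₂ ℤ (fun x y => x.1 * y.2 + x.2 * y.1 + c * (x.2 * y.2))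
      (fun x x' y => by simp; ring)
      (fun t x y => by simp; ring)
      (fun x y y' => by simp; ring)
      (fun t x y => by simp; ring)
  symm x y := by simp; ring

theorem plane_B (c : ℤ) (x y : ℤ × ℤ) :
    (plane c).B x y = x.1 * y.2 + x.2 * y.1 + c * (x.2 * y.2) := rfl

/-- The restriction of the form to a submodule. -/
abbrev sub (L : IntLat) (K : Submodule ℤ L.V) : IntLat where
  V := K
  B := L.B.domRestrict₁₂ K K
  symm x y := L.symm x y

theorem rank_prod (L M : IntLat) : (prod L M).rank = L.rank + M.rank := by
  unfold rank
  exact finrank_prod (R := ℤ) (M := L.V) (M' := M.V)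

theorem disc_prod (L M : IntLat) : (prod L M).disc = L.disc * M.disc := by
  rw [disc_eq (prod L M) ((finBasis ℤ L.V).prod (finBasis ℤ M.V))]
  have : gramMatrix (prod L M).B ((finBasis ℤ L.V).prod (finBasis ℤ M.V))
      = Matrix.fromBlocks (gramMatrix L.B (finBasis ℤ L.V)) 0 0
        (gramMatrix M.B (finBasis ℤ M.V)) := by
    ext i j
    rcases i with i | i <;> rcases j with j | j <;> simp [gramMatrix]
  rw [this, Matrix.det_fromBlocks_zero₂₁]
  rfl

theorem rank_line (a : ℤ) : (line a).rank = 1 := finrank_self ℤ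

theorem disc_line (a : ℤ) : (line a).disc = a := by
  rw [disc_eq (line a) (Basis.singleton Unit ℤ)]
  simp [gramMatrix]

theorem rank_plane (c : ℤ) : (plane c).rank = 2 := by
  unfold rank
  exact (finrank_prod (R := ℤ) (M := ℤ) (M' := ℤ)).trans (by simp)

theorem disc_plane (c : ℤ) : (plane c).disc = -1 := by
  rw [disc_eq (plane c) (Basis.finTwoProd ℤ)]
  simp [gramMatrix, Matrix.det_fin_two]

theorem prod_congr {L L' M M' : IntLat} : Iso L L' → Iso M M' → Iso (prod L M) (prod L' M') := by
  rintro ⟨e, he⟩ ⟨f, hf⟩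
  exact ⟨LinearEquiv.prodCongr e f, fun x y => congrArg₂ (· + ·) (he x.1 y.1) (hf x.2 y.2)⟩

theorem prod_comm (L M : IntLat) : Iso (prod L M) (prod M L) :=
  ⟨LinearEquiv.prodComm ℤ _ _, fun x y => by simp [add_comm]⟩

theorem prod_assoc (L M N : IntLat) : Iso (prod (prod L M) N) (prod L (prod M N)) :=
  ⟨LinearEquiv.prodAssoc ℤ _ _ _, fun x y => by simp [add_assoc]⟩

theorem prod_left_comm (L M N : IntLat) : Iso (prod L (prod M N)) (prod M (prod L N)) :=
  (prod_assoc L M N).symm.trans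
    ((prod_congr (prod_comm L M) (Iso.refl N)).trans (prod_assoc M L N))

/-- All norms are even. -/
def IsEven (L : IntLat) : Prop := ∀ x, Even (L.B x x)

/-- There is no nonzero vector of norm zero. -/
def Aniso (L : IntLat) : Prop := ∀ x, L.B x x = 0 → x = 0

/-- The form is negative definite. -/
def NegDef (L : IntLat) : Prop := ∀ x, 0 ≤ L.B x x → x = 0

/-- The orthogonal complement of a vector. -/
abbrev perp (L : IntLat) (v : L.V) : IntLat := L.sub (LinearMap.ker (L.B v))

theorem perp_orth (L : IntLat) (v : L.V) (x : (L.perp v).V) :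
    L.B v ((LinearMap.ker (L.B v)).subtype x) = 0 := LinearMap.mem_ker.1 x.2

theorem exists_primitive_functional {V : Type} [AddCommGroup V] [Module.Free ℤ V]
    [Module.Finite ℤ V] {f : V →ₗ[ℤ] ℤ} (hf : f ≠ 0) :
    ∃ (g : ℤ) (f₀ : V →ₗ[ℤ] ℤ) (z : V), f = g • f₀ ∧ f₀ z = 1 := by
  obtain ⟨g, f₀, F, h1, h2⟩ := exists_primitive hf
  refine ⟨g, f₀, (Module.evalEquiv ℤ V).symm F, h1, ?_⟩
  rw [← h2, ← Module.Dual.eval_apply, ← Module.evalEquiv_apply, LinearEquiv.apply_symm_apply]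

theorem disc_perp (L : IntLat) (v : L.V) (hv : L.B v v ≠ 0) :
    L.rank = (L.perp v).rank + 1 ∧
      ∃ g : ℤ, g ≠ 0 ∧ L.B v v * L.disc = g ^ 2 * (L.perp v).disc := by
  have hf : L.B v ≠ 0 := fun h => hv (by rw [h]; rfl)
  obtain ⟨g, f, z, hg, hz⟩ := exists_primitive_functional hf
  have hg0 : g ≠ 0 := by rintro rfl; exact hf (by rw [hg, zero_smul])
  have hker : LinearMap.ker (L.B v) = LinearMap.ker f := by
    ext x; simp [hg, hg0]
  have hperp : L.perp v = L.sub (LinearMap.ker f) := by unfold perp; rw [hker]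
  rw [hperp]
  refine ⟨ker_finrank hz, g, hg0, ?_⟩
  let b := finBasis ℤ (LinearMap.ker f)
  let c := consBasis f z hz b
  have hc0 : c.repr v 0 = f v := by
    conv_rhs => rw [← c.sum_repr v]
    rw [map_sum, Fin.sum_univ_succ, Finset.sum_eq_zero]
    · simp [c, consBasis_zero, hz]
    · intro i _
      simp [c, consBasis_succ, LinearMap.mem_ker.1 (b i).2]
  have h1 := Matrix.det_updateRow_sum (gramMatrix L.B c) 0 (c.repr v)
  have h2 : (∑ k, c.repr v k • gramMatrix L.B c k) = fun j => g * f (c j) := by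
    ext j
    have : L.B v (c j) = g * f (c j) := by rw [hg]; rfl
    rw [← this]
    have h := congrArg (fun u => L.B u (c j)) (c.sum_repr v)
    simp only [map_sum, map_smul, LinearMap.sum_apply, LinearMap.smul_apply] at h
    rw [← h]
    simp [gramMatrix]
  rw [h2, hc0, Matrix.det_succ_row_zero, Fin.sum_univ_succ, Finset.sum_eq_zero] at h1
  · have h3 : (Matrix.updateRow (gramMatrix L.B c) 0 fun j => g * f (c j)).submatrix Fin.succ
        (Fin.succAbove 0) = gramMatrix (L.sub (LinearMap.ker f)).B b := by
      ext i j
      simp [gramMatrix, c, consBasis_succ]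
      rfl
    rw [h3, ← L.disc_eq c] at h1
    have h4 : L.B v v = g * f v := by conv_lhs => rw [hg]
                                      rfl
    have h5 : (gramMatrix (L.sub (LinearMap.ker f)).B b).det = (L.sub (LinearMap.ker f)).disc := rfl
    rw [h5] at h1
    simp [c, consBasis_zero, hz] at h1
    rw [h4]
    linear_combination -g * h1
  · intro i _
    simp [c, consBasis_succ, LinearMap.mem_ker.1 (b i).2]

theorem sq_dvd_disc (L : IntLat) {z : L.V} {f : L.V →ₗ[ℤ] ℤ} (hz : f z = 1) {h : ℤ}
    (h1 : ∀ x, h ∣ L.B z x) (h2 : h ^ 2 ∣ L.B z z) : h ^ 2 ∣ L.disc := by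
  let b := finBasis ℤ (LinearMap.ker f)
  let c := consBasis f z hz b
  rw [L.disc_eq c]
  choose t ht using h1
  obtain ⟨α, hα⟩ := h2
  let G : Matrix (Fin (finrank ℤ (LinearMap.ker f) + 1))
      (Fin (finrank ℤ (LinearMap.ker f) + 1)) ℤ :=
    Matrix.of (Fin.cons (Fin.cons α fun j => t (b j))
      fun i => Fin.cons (t (b i)) fun j => L.B (b i) (b j))
  let D : Matrix (Fin (finrank ℤ (LinearMap.ker f) + 1))
      (Fin (finrank ℤ (LinearMap.ker f) + 1)) ℤ :=
    Matrix.diagonal (Fin.cons h fun _ => 1)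
  have hD : D.det = h := by simp [D, Matrix.det_diagonal, Fin.prod_univ_succ]
  have : gramMatrix L.B c = D * G * D := by
    ext i j
    rw [Matrix.mul_diagonal, Matrix.diagonal_mul]
    refine Fin.cases ?_ (fun i => ?_) i <;> refine Fin.cases ?_ (fun j => ?_) j
    · simp [gramMatrix, c, G, consBasis_zero, hα]; ring
    · simp [gramMatrix, c, G, consBasis_zero, consBasis_succ, ht]
    · simp [gramMatrix, c, G, consBasis_zero, consBasis_succ, L.symm _ z, ht]; ring
    · simp [gramMatrix, c, G, consBasis_succ]
  rw [this, Matrix.det_mul, Matrix.det_mul, hD]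
  exact ⟨G.det, by ring⟩

theorem hermite (L : IntLat) (ha : L.Aniso) (n : ℕ) (hn : L.rank = n + 1) :
    ∃ v : L.V, v ≠ 0 ∧ |L.B v v| ^ (n + 1) * 3 ^ ((n + 1) * n / 2)
      ≤ 4 ^ ((n + 1) * n / 2) * |L.disc| := by
  let b : Basis (Fin (n + 1)) ℤ L.V := finBasisOfFinrankEq ℤ _ hn
  let B' : L.V →ₗ[ℤ] L.V →ₗ[ℤ] ℚ := LinearMap.mk₂ ℤ (fun x y => (L.B x y : ℚ))
      (fun x x' y => by simp)
      (fun t x y => by simp)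
      (fun x y y' => by simp)
      (fun t x y => by simp)
  obtain ⟨v, hv, h⟩ := hermite_bound n L.V B' b (fun x y => by simp [B', L.symm x y])
    (fun x hx => ha x (by simpa [B'] using hx))
  refine ⟨v, hv, ?_⟩
  have hd : (gramMatrix B' b).det = (L.disc : ℚ) := by
    rw [L.disc_eq b, Int.cast_det]
    rfl
  rw [hd] at h
  have hB : B' v v = (L.B v v : ℚ) := rfl
  rw [hB] at h
  exact_mod_cast h

theorem exists_norm_lt (L : IntLat) (ha : L.Aniso) {n m : ℕ} {d : ℤ} (hn : L.rank = n + 1)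
    (hd : |L.disc| ≤ d)
    (hm : 4 ^ ((n + 1) * n / 2) * d < (m : ℤ) ^ (n + 1) * 3 ^ ((n + 1) * n / 2)) :
    ∃ v : L.V, L.B v v ≠ 0 ∧ |L.B v v| < m := by
  obtain ⟨v, hv, h⟩ := L.hermite ha n hn
  refine ⟨v, fun h0 => hv (ha v h0), ?_⟩
  by_contra hlt
  have h1 : (m : ℤ) ^ (n + 1) ≤ |L.B v v| ^ (n + 1) :=
    pow_le_pow_left₀ (by positivity) (not_lt.1 hlt) _
  have h2 : (m : ℤ) ^ (n + 1) * 3 ^ ((n + 1) * n / 2)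
      ≤ |L.B v v| ^ (n + 1) * 3 ^ ((n + 1) * n / 2) := by gcongr
  have h3 : (4 : ℤ) ^ ((n + 1) * n / 2) * |L.disc| ≤ 4 ^ ((n + 1) * n / 2) * d := by gcongr
  linarith

theorem Iso.isEven {L M : IntLat} (h : Iso L M) (hL : L.IsEven) : M.IsEven := by
  obtain ⟨e, he⟩ := h.symm
  exact fun x => he x x ▸ hL (e x)

/-- An isometric copy of a nondegenerate lattice that together with a submodule orthogonal to it
spans everything splits off. -/
theorem split {L N : IntLat} (f : N.V →ₗ[ℤ] L.V) (hf : ∀ x y, L.B (f x) (f y) = N.B x y)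
    (hN : ∀ n, (∀ m, N.B m n = 0) → n = 0) (K : Submodule ℤ L.V)
    (ho : ∀ n, ∀ k ∈ K, L.B (f n) k = 0) (hs : ∀ x, ∃ n, x - f n ∈ K) :
    Iso L (prod N (L.sub K)) := by
  let g : N.V × K →ₗ[ℤ] L.V := f.coprod K.subtype
  have hg : ∀ x : N.V × K, g x = f x.1 + x.2 := fun x => rfl
  have hinj : Function.Injective g := by
    rw [injective_iff_map_eq_zero]
    rintro ⟨n, k⟩ h
    rw [hg] at h
    have hn : n = 0 := hN n fun m => by
      have := congrArg (L.B (f m)) h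
      rwa [map_add, hf, ho m _ k.2, add_zero, map_zero] at this
    subst hn
    have hk : k = 0 := by
      ext
      simpa using h
    rw [hk]; rfl
  have hsurj : Function.Surjective g := fun x => by
    obtain ⟨n, hn⟩ := hs x
    exact ⟨(n, ⟨_, hn⟩), by simp [hg]⟩
  refine Iso.symm ⟨LinearEquiv.ofBijective g (And.intro hinj hsurj), fun x y => ?_⟩
  change L.B (g x) (g y) = N.B x.1 y.1 + L.B x.2 y.2
  rw [hg, hg]
  have h1 : L.B x.2 (f y.1) = 0 := by rw [L.symm]; exact ho _ _ x.2.2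
  simp only [map_add, LinearMap.add_apply, hf, h1, ho x.1 _ y.2.2]
  ring

theorem line_split (L : IntLat) {ε : ℤ} (hε : ε = 1 ∨ ε = -1) (v : L.V) (hv : L.B v v = ε) :
    Iso L (prod (line ε) (L.perp v)) := by
  have h2 : ε * ε = 1 := by rcases hε with rfl | rfl <;> rfl
  have h0 : ε ≠ 0 := by rintro rfl; simp at h2
  refine split (N := line ε) (LinearMap.toSpanSingleton ℤ L.V v) ?_ ?_ _ ?_ ?_
  · intro (x : ℤ) (y : ℤ)
    rw [line_B]
    simp [hv]; ring
  · intro (n : ℤ) h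
    have := h (1 : ℤ)
    rw [line_B] at this
    simpa [h0] using this
  · intro (n : ℤ) k hk
    rw [LinearMap.mem_ker] at hk
    simp [hk]
  · intro x
    refine ⟨(ε * L.B v x : ℤ), ?_⟩
    rw [LinearMap.mem_ker, map_sub, LinearMap.toSpanSingleton_apply, map_smul, hv, smul_eq_mul]
    linear_combination -(L.B v x) * h2

theorem plane_split (L : IntLat) {c : ℤ} (z w : L.V) (hz : L.B z z = 0) (hzw : L.B z w = 1)
    (hw : L.B w w = c) :
    Iso L (prod (plane c) (L.sub (LinearMap.ker (L.B z) ⊓ LinearMap.ker (L.B w)))) := by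
  have hwz : L.B w z = 1 := by rw [L.symm, hzw]
  refine split (N := plane c)
    ((LinearMap.toSpanSingleton ℤ L.V z).coprod (LinearMap.toSpanSingleton ℤ L.V w)) ?_ ?_ _ ?_ ?_
  · intro (x : ℤ × ℤ) (y : ℤ × ℤ)
    rw [plane_B]
    simp [hz, hzw, hw, hwz]; ring
  · intro (n : ℤ × ℤ) h
    have h1 := h ((1, 0) : ℤ × ℤ)
    have h2 := h ((0, 1) : ℤ × ℤ)
    rw [plane_B] at h1 h2
    simp at h1 h2
    ext
    · simpa [h1] using h2
    · exact h1
  · intro (n : ℤ × ℤ) k hk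
    obtain ⟨h1, h2⟩ := Submodule.mem_inf.1 hk
    rw [LinearMap.mem_ker] at h1 h2
    simp [h1, h2]
  · intro x
    refine ⟨((L.B w x - c * L.B z x, L.B z x) : ℤ × ℤ), ?_⟩
    simp [hz, hzw, hw, hwz]; ring

theorem isotropic_split (L : IntLat) (hd : |L.disc| = 2) {x : L.V} (hx : x ≠ 0)
    (hxx : L.B x x = 0) :
    ∃ c K, (c = 0 ∨ c = 1) ∧ Iso L (prod (plane c) K) := by
  obtain ⟨g, z, f, rfl, hz⟩ := exists_primitive hx
  have hg : g ≠ 0 := by rintro rfl; simp at hx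
  have hzz : L.B z z = 0 := by simpa [hg] using hxx
  have hsq : ∀ h : ℤ, (∀ x, h ∣ L.B z x) → h ^ 2 ∣ L.disc := fun h h1 =>
    L.sq_dvd_disc hz h1 (by rw [hzz]; exact dvd_zero _)
  have hne : L.B z ≠ 0 := fun h => by
    have := hsq 0 (fun x => by rw [h]; simp)
    simp only [ne_eq, OfNat.ofNat_ne_zero, not_false_eq_true, zero_pow, zero_dvd_iff] at this
    simp [this] at hd
  obtain ⟨h, f₀, w, hh, hw⟩ := exists_primitive_functional hne
  have hB : ∀ x, L.B z x = h * f₀ x := fun x => by rw [hh]; rfl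
  have h1 : h ^ 2 ∣ 2 := by
    rw [← hd, dvd_abs]
    exact hsq h fun x => ⟨_, hB x⟩
  have h2 : h * h = 1 := by
    have hle := Int.le_of_dvd two_pos h1
    have : -2 < h := by nlinarith
    have : h < 2 := by nlinarith
    interval_cases h <;> simp_all
  set w' := h • w with hw'
  have hzw : L.B z w' = 1 := by rw [hw', map_smul, hB, hw, smul_eq_mul, mul_one, h2]
  have hwz : L.B w' z = 1 := by rw [L.symm, hzw]
  have key : ∀ t, L.B z (w' + t • z) = 1 ∧ L.B (w' + t • z) (w' + t • z) = L.B w' w' + 2 * t := by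
    intro t
    simp only [map_add, map_smul, LinearMap.add_apply, LinearMap.smul_apply, smul_eq_mul, hzz,
      hzw, hwz]
    constructor <;> ring
  rcases Int.even_or_odd' (L.B w' w') with ⟨k, hk | hk⟩
  · exact ⟨0, _, Or.inl rfl, L.plane_split z _ hzz (key (-k)).1
      ((key (-k)).2.trans (by rw [hk]; ring))⟩
  · exact ⟨1, _, Or.inr rfl, L.plane_split z _ hzz (key (-k)).1
      ((key (-k)).2.trans (by rw [hk]; ring))⟩

theorem isotropic_split_even (L : IntLat) (he : L.IsEven) (hd : |L.disc| = 2) {x : L.V} (hx : x ≠ 0)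
    (hxx : L.B x x = 0) :
    ∃ K, K.IsEven ∧ Iso L (prod (plane 0) K) := by
  obtain ⟨c, K, hc, h⟩ := L.isotropic_split hd hx hxx
  have h1 := h.isEven he
  have hc0 : c = 0 := by
    refine hc.resolve_right ?_
    rintro rfl
    have := h1 (((0, 1) : ℤ × ℤ), 0)
    rw [prod_B, plane_B] at this
    simp at this
  subst hc0
  refine ⟨K, fun k => ?_, h⟩
  have := h1 ((0 : ℤ × ℤ), k)
  rw [prod_B, plane_B] at this
  simpa using this

theorem exists_orthogonal_system {b : ℕ} (hb : Even b) (k : ℕ) :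
    ∀ (L : IntLat) (n : ℕ) (d : ℤ), L.Aniso → L.IsEven → L.rank = n + k → |L.disc| ≤ d →
      (∀ i < k, 4 ^ ((n + k - i) * (n + k - i - 1) / 2) * (d * b ^ i) <
        ((b + 2 : ℕ) : ℤ) ^ (n + k - i) * 3 ^ ((n + k - i) * (n + k - i - 1) / 2)) →
      ∃ w : Fin k → L.V, (∀ i j, i ≠ j → L.B (w i) (w j) = 0) ∧
        ∀ i, L.B (w i) (w i) ≠ 0 ∧ |L.B (w i) (w i)| ≤ b := by
  induction k with
  | zero => exact fun L n d _ _ _ _ _ => ⟨Fin.elim0, fun i => i.elim0, fun i => i.elim0⟩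
  | succ k ih =>
    intro L n d ha he hr hd hk
    obtain ⟨v, hv, hlt⟩ := L.exists_norm_lt ha (n := n + k) (m := b + 2) (d := d) hr hd
      (by simpa [add_assoc] using hk 0 (Nat.succ_pos k))
    have hle : |L.B v v| ≤ b := by
      obtain ⟨r, hr⟩ := he v
      obtain ⟨s, hs⟩ := hb
      rw [hs] at hlt ⊢
      push_cast at hlt ⊢
      rw [abs_lt] at hlt
      rw [abs_le]
      omega
    obtain ⟨hrk, g, hg, hgd⟩ := L.disc_perp v hv
    have hdp : |(L.perp v).disc| ≤ d * b := by
      have h1 : |(L.perp v).disc| ≤ |g ^ 2 * (L.perp v).disc| := by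
        rw [abs_mul]
        exact le_mul_of_one_le_left (abs_nonneg _) (Int.one_le_abs (pow_ne_zero 2 hg))
      rw [← hgd, abs_mul] at h1
      have h2 : |L.B v v| * |L.disc| ≤ b * d :=
        mul_le_mul hle hd (abs_nonneg _) (by positivity)
      linarith
    obtain ⟨w, hw1, hw2⟩ := ih (L.perp v) n (d * b)
      (fun x hx => Subtype.ext (ha _ hx)) (fun x => he _) (by omega) hdp (fun i hi => by
        have := hk (i + 1) (Nat.succ_lt_succ hi)
        rw [show n + (k + 1) - (i + 1) = n + k - i by omega] at this
        rw [show d * b * (b : ℤ) ^ i = d * b ^ (i + 1) by ring]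
        exact this)
    have ho : ∀ i, L.B v (w i : L.V) = 0 := fun i => L.perp_orth v (w i)
    refine ⟨Fin.cons v fun i => (w i : L.V), ?_, ?_⟩
    · intro i j
      refine Fin.cases ?_ (fun i => ?_) i <;> refine Fin.cases ?_ (fun j => ?_) j
      · exact fun h => absurd rfl h
      · exact fun _ => ho j
      · exact fun _ => (L.symm _ _).trans (ho i)
      · exact fun h => hw1 i j fun h' => h (h' ▸ rfl)
    · intro i
      refine Fin.cases ?_ (fun i => ?_) i
      · exact ⟨hv, hle⟩
      · exact hw2 i

/-- There are no two orthogonal vectors of positive norm with a nonzero vector of nonnegative norm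
orthogonal to both. -/
def AtMostTwoPos (L : IntLat) : Prop :=
  ∀ x y z, L.B x y = 0 → L.B x z = 0 → L.B y z = 0 → 0 < L.B x x → 0 < L.B y y →
    0 ≤ L.B z z → z = 0

/-- No nonzero vector of nonnegative norm is orthogonal to a vector of positive norm. -/
def AtMostOnePos (L : IntLat) : Prop :=
  ∀ x y, L.B x y = 0 → 0 < L.B x x → 0 ≤ L.B y y → y = 0

/-- Every vector of positive norm is orthogonal to another one. -/
def AtLeastTwoPos (L : IntLat) : Prop :=
  (∃ x, 0 < L.B x x) ∧ ∀ x, 0 < L.B x x → ∃ y, L.B x y = 0 ∧ 0 < L.B y y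

theorem AtMostOnePos.atMostTwoPos {L : IntLat} (h : L.AtMostOnePos) : L.AtMostTwoPos :=
  fun x _ z _ hxz _ hx _ hz => h x z hxz hx hz

theorem Iso.atMostTwoPos {L M : IntLat} (h : Iso L M) (hL : L.AtMostTwoPos) : M.AtMostTwoPos := by
  obtain ⟨e, he⟩ := h.symm
  intro x y z
  rw [← he, ← he, ← he, ← he, ← he, ← he]
  intro h1 h2 h3 h4 h5 h6
  exact e.map_eq_zero_iff.1 (hL _ _ _ h1 h2 h3 h4 h5 h6)

theorem Iso.atMostOnePos {L M : IntLat} (h : Iso L M) (hL : L.AtMostOnePos) : M.AtMostOnePos := by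
  obtain ⟨e, he⟩ := h.symm
  intro x y
  rw [← he, ← he, ← he]
  intro h1 h2 h3
  exact e.map_eq_zero_iff.1 (hL _ _ h1 h2 h3)

theorem Iso.atLeastTwoPos {L M : IntLat} (h : Iso L M) (hL : L.AtLeastTwoPos) :
    M.AtLeastTwoPos := by
  obtain ⟨e, he⟩ := h
  refine ⟨?_, fun x hx => ?_⟩
  · obtain ⟨x, hx⟩ := hL.1
    exact ⟨e x, by rwa [he]⟩
  · obtain ⟨y, hy1, hy2⟩ := hL.2 (e.symm x) (by rwa [← he, e.apply_symm_apply])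
    exact ⟨e y, by rwa [← e.apply_symm_apply x, he], by rwa [he]⟩

theorem atMostOnePos_of_plane_prod {c : ℤ} (hc : c = 0 ∨ c = 1) {L : IntLat}
    (h : (prod (plane c) L).AtMostTwoPos) : L.AtMostOnePos := by
  intro x y hxy hx hy
  have := h (((1, 1) : ℤ × ℤ), 0) ((0 : ℤ × ℤ), x) ((0 : ℤ × ℤ), y)
  simp only [LinearMap.mk₂_apply] at this
  refine congrArg Prod.snd (this ?_ ?_ ?_ ?_ ?_ ?_) <;> simp [*]
  rcases hc with rfl | rfl <;> simp

theorem negDef_of_plane_prod {c : ℤ} (hc : c = 0 ∨ c = 1) {L : IntLat}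
    (h : (prod (plane c) L).AtMostOnePos) : L.NegDef := by
  intro x hx
  have := h (((1, 1) : ℤ × ℤ), 0) ((0 : ℤ × ℤ), x)
  simp only [LinearMap.mk₂_apply] at this
  refine congrArg Prod.snd (this ?_ ?_ ?_) <;> simp [*]
  rcases hc with rfl | rfl <;> simp

theorem exists_pos_of_plane_prod {L : IntLat} (h : (prod (plane 0) L).AtLeastTwoPos) :
    ∃ x, 0 < L.B x x := by
  obtain ⟨⟨y, x⟩, h1, h2⟩ := h.2 (((1, 1) : ℤ × ℤ), 0) (by simp)
  refine ⟨x, ?_⟩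
  rw [prod_B, plane_B] at h1 h2
  simp at h1 h2
  have h3 : y.2 = -y.1 := by linarith
  rw [h3] at h2
  nlinarith [sq_nonneg y.1]

theorem atMostOnePos_line_prod {K : IntLat} (hK : K.NegDef) : (prod (line 1) K).AtMostOnePos := by
  rintro ⟨(s : ℤ), k⟩ ⟨(t : ℤ), l⟩
  simp only [LinearMap.mk₂_apply, one_mul]
  intro h1 h2 h3
  have hlk := K.symm l k
  have hn : K.B (t • k - s • l) (t • k - s • l)
      = t ^ 2 * (s * s + K.B k k) + s ^ 2 * (t * t + K.B l l) := by
    simp only [map_sub, map_smul, LinearMap.sub_apply, LinearMap.smul_apply, smul_eq_mul, hlk]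
    linear_combination (-2 * t * s) * h1
  have hz := hK _ (by rw [hn]; nlinarith [sq_nonneg t, sq_nonneg s])
  rw [hz] at hn
  simp only [map_zero] at hn
  have ht : t = 0 := by
    by_contra ht
    nlinarith [mul_pos (pow_pos (abs_pos.2 ht) 2) h2, sq_abs t, mul_nonneg (sq_nonneg s) h3]
  subst ht
  have hl : l = 0 := hK l (by simpa using h3)
  rw [hl]; rfl

set_option synthInstance.maxSize 1000 in
theorem exists_pair_false : ∀ s : Fin 5 → Bool,
    (∀ i j k, i ≠ j → i ≠ k → j ≠ k → s i = true → s j = true → s k = false) →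
    (∃ i, s i = true) →
    ∃ i j k, i ≠ j ∧ i ≠ k ∧ j ≠ k ∧ s i = true ∧ s j = false ∧ s k = false := by
  decide +kernel

theorem exists_isotropic_of_four (L : IntLat) {p a b c d : L.V} (hp : 0 < L.B p p)
    (hab : L.B a b = 0) (hac : L.B a c = 0) (had : L.B a d = 0) (hbc : L.B b c = 0)
    (hbd : L.B b d = 0) (hcd : L.B c d = 0) (ha : L.B a a = -8) (hb : L.B b b = -8)
    (hc : L.B c c = -8) (hd : L.B d d = -8) : ∃ x, x ≠ 0 ∧ L.B x x = 0 := by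
  obtain ⟨m, hm⟩ : ∃ m : ℕ,
      (m : ℤ) = 8 * L.B p p + L.B p a ^ 2 + L.B p b ^ 2 + L.B p c ^ 2 + L.B p d ^ 2 :=
    ⟨_, Int.toNat_of_nonneg (by positivity)⟩
  obtain ⟨x, y, z, w, h⟩ := Nat.sum_four_squares m
  have h' : (x : ℤ) ^ 2 + y ^ 2 + z ^ 2 + w ^ 2 = m := by exact_mod_cast h
  have hba := L.symm b a
  have hca := L.symm c a
  have hda := L.symm d a
  have hcb := L.symm c b
  have hdb := L.symm d b
  have hdc := L.symm d c
  have hap := L.symm a p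
  have hbp := L.symm b p
  have hcp := L.symm c p
  have hdp := L.symm d p
  set u := (8 : ℤ) • p + L.B p a • a + L.B p b • b + L.B p c • c + L.B p d • d with hu
  set v := u + (x : ℤ) • a + (y : ℤ) • b + (z : ℤ) • c + (w : ℤ) • d with hv
  have h1 : L.B u v = 8 * m := by
    rw [hv, hu, hm]
    simp only [map_add, map_smul, LinearMap.add_apply, LinearMap.smul_apply, smul_eq_mul, hba, hca,
      hda, hcb, hdb, hdc, hap, hbp, hcp, hdp, hab, hac, had, hbc, hbd, hcd, ha, hb, hc, hd]
    ring
  have h2 : L.B v v = 0 := by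
    have : L.B v v = 8 * m - 8 * ((x : ℤ) ^ 2 + y ^ 2 + z ^ 2 + w ^ 2) := by
      rw [hv, hu, hm]
      simp only [map_add, map_smul, LinearMap.add_apply, LinearMap.smul_apply, smul_eq_mul, hba,
        hca, hda, hcb, hdb, hdc, hap, hbp, hcp, hdp, hab, hac, had, hbc, hbd, hcd, ha, hb, hc, hd]
      ring
    rw [this, h', sub_self]
  refine ⟨v, fun h0 => ?_, h2⟩
  rw [h0, map_zero, hm] at h1
  nlinarith [sq_nonneg (L.B p a), sq_nonneg (L.B p b), sq_nonneg (L.B p c), sq_nonneg (L.B p d)]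

theorem exists_norm_neg_eight (L : IntLat) {a b : L.V} (hab : L.B a b = 0)
    (h : L.B a a = L.B b b) (ha : L.B a a = -2 ∨ L.B a a = -4) :
    ∃ α β γ δ : ℤ, L.B (α • a + β • b) (γ • a + δ • b) = 0 ∧
      L.B (α • a + β • b) (α • a + β • b) = -8 ∧ L.B (γ • a + δ • b) (γ • a + δ • b) = -8 := by
  have hba : L.B b a = 0 := by rw [L.symm, hab]
  rcases ha with ha | ha
  · exact ⟨2, 0, 0, 2, by simp [hab], by simp [ha], by simp [← h, ha]⟩
  · exact ⟨1, 1, 1, -1, by simp [hab, hba, ← h], by simp [hab, hba, ← h, ha],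
      by simp [hab, hba, ← h, ha]⟩

theorem exists_isotropic_of_pairs (L : IntLat) {p a b c d : L.V} (hp : 0 < L.B p p)
    (hab : L.B a b = 0) (hac : L.B a c = 0) (had : L.B a d = 0) (hbc : L.B b c = 0)
    (hbd : L.B b d = 0) (hcd : L.B c d = 0) (h : L.B a a = L.B b b) (h' : L.B c c = L.B d d)
    (ha : L.B a a = -2 ∨ L.B a a = -4) (hc : L.B c c = -2 ∨ L.B c c = -4) :
    ∃ x, x ≠ 0 ∧ L.B x x = 0 := by
  obtain ⟨α, β, γ, δ, h1, h2, h3⟩ := L.exists_norm_neg_eight hab h ha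
  obtain ⟨α', β', γ', δ', h1', h2', h3'⟩ := L.exists_norm_neg_eight hcd h' hc
  refine L.exists_isotropic_of_four hp h1 ?_ ?_ ?_ ?_ h1' h2 h3 h2' h3' <;>
  simp [hac, had, hbc, hbd]

theorem exists_isotropic_of_five (L : IntLat) (h2 : L.AtMostTwoPos) {p : L.V} (hp : 0 < L.B p p)
    (w : Fin 5 → L.V) (ho : ∀ i j, i ≠ j → L.B (w i) (w j) = 0)
    (hw : ∀ i, L.B (w i) (w i) = 2 ∨ L.B (w i) (w i) = -2 ∨ L.B (w i) (w i) = 4 ∨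
      L.B (w i) (w i) = -4) : ∃ x, x ≠ 0 ∧ L.B x x = 0 := by
  have hw0 : ∀ i, w i ≠ 0 := fun i h => by
    have := hw i
    simp [h] at this
  have aux : ∀ {x i}, L.B x (w i) ≠ 0 → x ≠ 0 := by
    rintro x i h rfl
    simp at h
  have comb : ∀ (i : Fin 5) (u : L.V) (t : ℤ), t ≠ 0 → L.B u (w i) = 0 →
      t ^ 2 * L.B (w i) (w i) + L.B u u = 0 → ∃ x, x ≠ 0 ∧ L.B x x = 0 := by
    intro i u t ht hu h0
    refine ⟨t • w i + u, aux (i := i) ?_, ?_⟩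
    · have := hw i
      simp only [map_add, map_smul, LinearMap.add_apply, LinearMap.smul_apply, hu, smul_eq_mul,
        add_zero]
      refine mul_ne_zero ht ?_
      omega
    · have hu' : L.B (w i) u = 0 := by rw [L.symm, hu]
      simp only [map_add, map_smul, LinearMap.add_apply, LinearMap.smul_apply, hu, hu', smul_eq_mul]
      linear_combination h0
  by_cases hpos : ∃ i, 0 < L.B (w i) (w i)
  · obtain ⟨i, j, k, hij, hik, hjk, hi, hj, hk⟩ :=
      exists_pair_false (fun i => decide (0 < L.B (w i) (w i)))
      (fun i j k hij hik hjk hi hj => by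
        simp only [decide_eq_true_eq, decide_eq_false_iff_not] at hi hj ⊢
        exact fun hk => hw0 k (h2 _ _ _ (ho i j hij) (ho i k hik) (ho j k hjk) hi hj hk.le))
      (by simpa using hpos)
    simp only [decide_eq_true_eq, decide_eq_false_iff_not, not_lt] at hi hj hk
    have hji := ho j i hij.symm
    have hki := ho k i hik.symm
    have hjk' := ho j k hjk
    have hkj := ho k j hjk.symm
    by_cases h1 : L.B (w i) (w i) + L.B (w j) (w j) = 0
    · exact comb i (w j) 1 one_ne_zero hji (by linear_combination h1)
    by_cases h3 : L.B (w i) (w i) + L.B (w k) (w k) = 0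
    · exact comb i (w k) 1 one_ne_zero hki (by linear_combination h3)
    rcases hw i with h | h | h | h
    · refine comb i (w j + w k) 2 two_ne_zero (by simp [hji, hki]) ?_
      have hj' := hw j
      have hk' := hw k
      simp [hjk', hkj]
      omega
    · omega
    · refine comb i (w j + w k) 1 one_ne_zero (by simp [hji, hki]) ?_
      have hj' := hw j
      have hk' := hw k
      simp [hjk', hkj]
      omega
    · omega
  · push Not at hpos
    have hneg : ∀ i, L.B (w i) (w i) = -2 ∨ L.B (w i) (w i) = -4 := fun i => by
      have h1 := hpos i
      have h3 := hw i
      omega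
    have key : ∀ s : Fin 5 → Bool, ∃ i j k l, i ≠ j ∧ i ≠ k ∧ i ≠ l ∧ j ≠ k ∧ j ≠ l ∧ k ≠ l ∧
        s i = s j ∧ s k = s l := by
      decide +kernel
    obtain ⟨i, j, k, l, hij, hik, hil, hjk, hjl, hkl, h1, h3⟩ :=
      key (fun i => decide (L.B (w i) (w i) = -2))
    have conv : ∀ i j, decide (L.B (w i) (w i) = -2) = decide (L.B (w j) (w j) = -2) →
        L.B (w i) (w i) = L.B (w j) (w j) := fun i j h => by
      have hi := hneg i
      have hj := hneg j
      rw [decide_eq_decide] at h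
      omega
    exact L.exists_isotropic_of_pairs hp (ho _ _ hij) (ho _ _ hik) (ho _ _ hil) (ho _ _ hjk)
      (ho _ _ hjl) (ho _ _ hkl) (conv _ _ h1) (conv _ _ h3) (hneg _) (hneg _)

theorem exists_isotropic (L : IntLat) (he : L.IsEven) (hd : |L.disc| = 2)
    (hr : L.rank = 11 ∨ L.rank = 9) (h2 : L.AtMostTwoPos) {p : L.V} (hp : 0 < L.B p p) :
    ∃ x, x ≠ 0 ∧ L.B x x = 0 := by
  by_contra hcon
  have ha : L.Aniso := fun x hx => by_contra fun h => hcon ⟨x, h, hx⟩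
  have hw : ∃ w : Fin 5 → L.V, (∀ i j, i ≠ j → L.B (w i) (w j) = 0) ∧
        ∀ i, L.B (w i) (w i) ≠ 0 ∧ |L.B (w i) (w i)| ≤ 4 := by
    rcases hr with hr | hr
    · exact exists_orthogonal_system (b := 4) (by decide) 5 L 6 2 ha he hr hd.le
        (fun i hi => by interval_cases i <;> norm_num)
    · obtain ⟨w, h1, h3⟩ := exists_orthogonal_system (b := 2) (by decide) 5 L 4 2 ha he hr hd.le
        (fun i hi => by interval_cases i <;> norm_num)
      exact ⟨w, h1, fun i => ⟨(h3 i).1, (h3 i).2.trans (by norm_num)⟩⟩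
  obtain ⟨w, ho, hw⟩ := hw
  refine hcon (L.exists_isotropic_of_five h2 hp w ho fun i => ?_)
  obtain ⟨h1, h3⟩ := hw i
  obtain ⟨r, hr⟩ := he (w i)
  rw [abs_le] at h3
  omega

theorem prod_congr_right (L : IntLat) {M M' : IntLat} (h : Iso M M') :
    Iso (prod L M) (prod L M') := prod_congr (Iso.refl L) h

theorem plane_one_iso : Iso (plane 1) (prod (line 1) (line (-1))) := by
  refine Iso.symm (Iso.of_embedding (L := prod (line 1) (line (-1))) (M := plane 1)
    ((LinearMap.toSpanSingleton ℤ (ℤ × ℤ) (0, 1)).coprod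
      (LinearMap.toSpanSingleton ℤ (ℤ × ℤ) (1, -1))) ?_ ?_ ?_ ?_)
  · intro (x : ℤ × ℤ) (y : ℤ × ℤ)
    simp
    ring
  · rw [rank_prod, rank_line, rank_line, rank_plane]
  · rw [disc_prod, disc_line, disc_line, disc_plane]; rfl
  · rw [disc_prod, disc_line, disc_line]; decide

theorem line_prod_plane_one_iso {ε : ℤ} (hε : ε = 1 ∨ ε = -1) :
    Iso (prod (line ε) (plane 1)) (prod (line ε) (plane 0)) := by
  obtain ⟨k, hk⟩ : ∃ k : ℤ, 2 * k + ε = 1 := by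
    rcases hε with rfl | rfl
    · exact ⟨0, rfl⟩
    · exact ⟨1, rfl⟩
  have h2 : ε * ε = 1 := by rcases hε with rfl | rfl <;> rfl
  refine Iso.of_embedding (L := prod (line ε) (plane 1)) (M := prod (line ε) (plane 0))
    ((LinearMap.toSpanSingleton ℤ (ℤ × ℤ × ℤ) (1, -ε, 0)).coprod
      ((LinearMap.toSpanSingleton ℤ (ℤ × ℤ × ℤ) (0, 1, 0)).coprod
        (LinearMap.toSpanSingleton ℤ (ℤ × ℤ × ℤ) (1, k, 1)))) ?_ ?_ ?_ ?_
  · intro (x : ℤ × ℤ × ℤ) (y : ℤ × ℤ × ℤ)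
    simp
    linear_combination (x.2.2 * y.2.2) * hk
  · simp only [rank_prod, rank_plane]
  · simp only [disc_prod, disc_plane]
  · simp only [disc_prod, disc_plane, disc_line]
    rcases hε with rfl | rfl <;> decide

theorem line_prod_plane_iso {ε c : ℤ} (hε : ε = 1 ∨ ε = -1) (hc : c = 0 ∨ c = 1) :
    Iso (prod (line ε) (plane c)) (prod (line ε) (prod (line 1) (line (-1)))) := by
  have h := prod_congr_right (line ε) plane_one_iso
  rcases hc with rfl | rfl
  · exact (line_prod_plane_one_iso hε).symm.trans h
  · exact h

theorem line_prod_plane_prod_iso {ε c : ℤ} (hε : ε = 1 ∨ ε = -1) (hc : c = 0 ∨ c = 1)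
    (L : IntLat) :
    Iso (prod (line ε) (prod (plane c) L))
      (prod (line ε) (prod (line (-1)) (prod (line 1) L))) :=
  ((prod_assoc _ _ _).symm.trans (prod_congr (line_prod_plane_iso hε hc) (Iso.refl L))).trans
    ((prod_assoc _ _ _).trans (prod_congr_right _
      ((prod_assoc _ _ _).trans (prod_left_comm _ _ _))))

/-- The lattice `⟨-1⟩ᵏ ⊥ ⟨-2⟩`. -/
def stdNeg : ℕ → IntLat
  | 0 => line (-2)
  | k + 1 => prod (line (-1)) (stdNeg k)

theorem iso_line_of_rank_one (K : IntLat) (hK : K.NegDef) (hr : K.rank = 1) (hd : |K.disc| = 2) :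
    Iso K (line (-2)) := by
  let b : Basis (Fin 1) ℤ K.V := finBasisOfFinrankEq ℤ _ hr
  have h1 : K.disc = K.B (b 0) (b 0) := by
    rw [K.disc_eq b, Matrix.det_fin_one]; rfl
  have h2 : K.disc = -2 := by
    have : ¬ 0 ≤ K.disc := fun h => b.ne_zero 0 (hK _ (h1 ▸ h))
    rcases (abs_eq (by norm_num)).1 hd with h | h
    · omega
    · exact h
  refine
    (Iso.of_embedding (L := line (-2)) (LinearMap.toSpanSingleton ℤ K.V (b 0)) ?_ ?_ ?_ ?_).symm
  · intro (x : ℤ) (y : ℤ)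
    simp [← h1, h2]; ring
  · rw [rank_line, hr]
  · rw [disc_line, h2]
  · rw [disc_line]; decide

theorem NegDef.aniso {K : IntLat} (hK : K.NegDef) : K.Aniso := fun x hx => hK x hx.ge

theorem NegDef.sub {K : IntLat} (hK : K.NegDef) (S : Submodule ℤ K.V) : (K.sub S).NegDef :=
  fun x hx => Subtype.ext (hK x hx)

theorem NegDef.of_prod_right {L K : IntLat} (h : (prod L K).NegDef) : K.NegDef := fun x hx =>
  congrArg Prod.snd (h ((0 : L.V), x) (by simpa using hx))

theorem NegDef.neg {K : IntLat} (hK : K.NegDef) {x : K.V} (hx : K.B x x ≠ 0) : K.B x x < 0 := by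
  by_contra h
  have := hK x (not_lt.1 h)
  simp [this] at hx

theorem line_prod_iso_of_norm_neg_two (K : IntLat) (hK : K.NegDef) (hd : |K.disc| = 2) {r s : K.V}
    (hr : K.B r r = -2) (hs : K.B s s = -2) (hrs : K.B r s = 0) :
    ∃ K' : IntLat, K'.NegDef ∧ |K'.disc| = 2 ∧ K.rank = K'.rank + 2 ∧
      Iso (prod (line 1) K) (prod (line (-1)) (prod (line (-1)) (prod (line 1) K'))) := by
  have hsr : K.B s r = 0 := by rw [K.symm, hrs]
  set P := prod (line 1) K with hP
  let v : P.V := ((1 : ℤ), r)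
  let x : P.V := ((2 : ℤ), r + s)
  have hv : P.B v v = -1 := by simp [P, v, hr]
  have hvx : P.B v x = 0 := by simp [P, v, x, hr, hrs]
  have hxx : P.B x x = 0 := by simp [P, x, hr, hrs, hs, hsr]
  have i1 := P.line_split (Or.inr rfl) v hv
  have d1 := i1.disc_eq
  have r1 := i1.rank_eq
  have d0 : P.disc = K.disc := by rw [hP, disc_prod, disc_line, one_mul]
  have r0 : P.rank = 1 + K.rank := by rw [hP, rank_prod, rank_line]
  rw [d0, disc_prod, disc_line] at d1
  rw [r0, rank_prod, rank_line] at r1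
  have hd1 : |(P.perp v).disc| = 2 := by
    rw [← hd, d1, neg_one_mul, abs_neg]
  obtain ⟨c, K', hc, i2⟩ := (P.perp v).isotropic_split hd1
    (x := ⟨x, LinearMap.mem_ker.2 hvx⟩) (fun h => by
      have h1 : x = 0 := congrArg Subtype.val h
      have h2 : (2 : ℤ) = 0 := congrArg Prod.fst h1
      omega) hxx
  have d2 := i2.disc_eq
  have r2 := i2.rank_eq
  rw [disc_prod, disc_plane] at d2
  rw [rank_prod, rank_plane] at r2
  have i3 : Iso P (prod (line (-1)) (prod (plane c) K')) := i1.trans (prod_congr_right _ i2)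
  refine ⟨K', ?_, ?_, ?_, i3.trans ((line_prod_plane_prod_iso (Or.inr rfl) hc K'))⟩
  · exact NegDef.of_prod_right (negDef_of_plane_prod hc
      ((i3.trans (prod_left_comm _ _ _)).atMostOnePos (atMostOnePos_line_prod hK)))
  · rw [← hd1, d2, neg_one_mul, abs_neg]
  · change 1 + K.rank = 1 + (P.perp v).rank at r1
    omega

theorem exists_orthogonal_norm_neg_two (K : IntLat) (hK : K.NegDef) {k : ℕ} (h3 : 3 ≤ k)
    (hk : k ≤ 5) (hr : K.rank = k + 2) (hd : |K.disc| = 2) (hn : ∀ v, K.B v v ≠ -1) :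
    ∃ r s, K.B r r = -2 ∧ K.B s s = -2 ∧ K.B r s = 0 := by
  have key : ∀ v, K.B v v ≠ 0 → |K.B v v| < (3 : ℕ) → K.B v v = -2 := fun v h0 h => by
    have h1 := hK.neg h0
    have h2 := hn v
    rw [abs_lt] at h
    push_cast at h
    omega
  obtain ⟨r, h0, hlt⟩ := K.exists_norm_lt hK.aniso (n := k + 1) (m := 3) hr hd.le (by
    interval_cases k <;> norm_num)
  have hrr := key r h0 hlt
  obtain ⟨hrk, g, hg, hgd⟩ := K.disc_perp r h0
  have hdp : |(K.perp r).disc| ≤ 4 := by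
    have h1 : |(K.perp r).disc| ≤ |g ^ 2 * (K.perp r).disc| := by
      rw [abs_mul]
      exact le_mul_of_one_le_left (abs_nonneg _) (Int.one_le_abs (pow_ne_zero 2 hg))
    rw [← hgd, abs_mul, hrr, hd] at h1
    simpa using h1
  obtain ⟨s, h0', hlt'⟩ := (K.perp r).exists_norm_lt (hK.sub _).aniso (n := k) (m := 3)
    (by omega) hdp (by interval_cases k <;> norm_num)
  exact ⟨r, s, hrr, key _ h0' hlt', K.perp_orth r s⟩

theorem exists_norm_neg_one (K : IntLat) (hK : K.NegDef) {k : ℕ} (hk : k ≤ 2)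
    (hr : K.rank = k + 2) (hd : |K.disc| = 2) : ∃ v, K.B v v = -1 := by
  obtain ⟨r, h0, hlt⟩ := K.exists_norm_lt hK.aniso (n := k + 1) (m := 2) hr hd.le (by
    interval_cases k <;> norm_num)
  have h1 := hK.neg h0
  rw [abs_lt] at hlt
  push_cast at hlt
  exact ⟨r, by omega⟩

theorem line_prod_iso_stdNeg (k : ℕ) : ∀ K : IntLat, k ≤ 6 → K.NegDef → K.rank = k + 1 →
    |K.disc| = 2 → Iso (prod (line 1) K) (prod (line 1) (stdNeg k)) := by
  induction k using Nat.strong_induction_on with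
  | _ k ih =>
    intro K hk hK hr hd
    rcases k with _ | k
    · exact prod_congr_right _ (K.iso_line_of_rank_one hK hr hd)
    by_cases hn : ∃ v, K.B v v = -1
    · obtain ⟨v, hv⟩ := hn
      have i1 := K.line_split (Or.inr rfl) v hv
      have d1 := i1.disc_eq
      have r1 := i1.rank_eq
      rw [disc_prod, disc_line] at d1
      rw [rank_prod, rank_line] at r1
      have i2 := ih k (Nat.lt_succ_self k) (K.perp v) (by omega) (hK.sub _)
        (by change K.rank = 1 + (K.perp v).rank at r1; omega)
        (by rw [← hd, d1, neg_one_mul, abs_neg])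
      exact (prod_congr_right _ i1).trans ((prod_left_comm _ _ _).trans
        ((prod_congr_right _ i2).trans (prod_left_comm _ _ _)))
    have h3 : 3 ≤ k := by
      by_contra h
      exact hn (K.exists_norm_neg_one hK (by omega) hr hd)
    obtain ⟨r, s, hrr, hss, hrs⟩ := K.exists_orthogonal_norm_neg_two hK h3 (by omega) hr hd
      (not_exists.1 hn)
    obtain ⟨K', hK', hd', hr', i1⟩ := K.line_prod_iso_of_norm_neg_two hK hd hrr hss hrs
    obtain ⟨j, rfl⟩ : ∃ j, k = j + 1 := ⟨k - 1, by omega⟩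
    have i2 := ih j (by omega) K' (by omega) hK' (by omega) hd'
    exact i1.trans ((prod_congr_right _ ((prod_congr_right _ i2).trans
      (prod_left_comm _ _ _))).trans (prod_left_comm _ _ _))

/-- The lattice `⟨1⟩ ⊥ ⟨-1⟩ ⊥ L`. -/
abbrev oddExt (L : IntLat) : IntLat := prod (line 1) (prod (line (-1)) L)

theorem oddExt_B (L : IntLat) (x y : ℤ × ℤ × L.V) :
    L.oddExt.B x y = x.1 * y.1 - x.2.1 * y.2.1 + L.B x.2.2 y.2.2 := by
  change 1 * (x.1 * y.1) + (-1 * (x.2.1 * y.2.1) + L.B x.2.2 y.2.2) = _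
  ring

theorem plane_prod_B (L : IntLat) (x y : (ℤ × ℤ) × L.V) :
    (prod (plane 0) L).B x y = x.1.1 * y.1.2 + x.1.2 * y.1.1 + L.B x.2 y.2 := by
  change x.1.1 * y.1.2 + x.1.2 * y.1.1 + 0 * (x.1.2 * y.1.2) + L.B x.2 y.2 = _
  ring

/-- The embedding of `U ⊥ L` into `⟨1⟩ ⊥ ⟨-1⟩ ⊥ L` multiplying the form by `4`. -/
def toOddExt (L : IntLat) : (ℤ × ℤ) × L.V →ₗ[ℤ] ℤ × ℤ × L.V where
  toFun x := (2 * x.1.1 + x.1.2, 2 * x.1.1 - x.1.2, (2 : ℤ) • x.2)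
  map_add' x y := by
    ext
    · simp; ring
    · simp; ring
    · simp
  map_smul' t x := by
    ext
    · simp; ring
    · simp; ring
    · simp [smul_comm t]

theorem toOddExt_apply (L : IntLat) (x : (ℤ × ℤ) × L.V) :
    L.toOddExt x = (2 * x.1.1 + x.1.2, 2 * x.1.1 - x.1.2, (2 : ℤ) • x.2) := rfl

theorem toOddExt_B (L : IntLat) (x y : (ℤ × ℤ) × L.V) :
    L.oddExt.B (L.toOddExt x) (L.toOddExt y) = 4 * (prod (plane 0) L).B x y := by
  rw [oddExt_B, plane_prod_B, toOddExt_apply, toOddExt_apply]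
  simp only [map_smul, LinearMap.smul_apply, smul_eq_mul]
  ring

theorem toOddExt_injective (L : IntLat) : Function.Injective L.toOddExt := by
  rw [injective_iff_map_eq_zero]
  rintro ⟨⟨s, t⟩, z⟩ h
  rw [toOddExt_apply] at h
  simp only [Prod.mk_eq_zero, smul_eq_zero, OfNat.ofNat_ne_zero, false_or] at h ⊢
  exact ⟨by omega, h.2.2⟩

theorem mem_range_toOddExt (L : IntLat) {x : ℤ × ℤ × L.V} (h : 4 ∣ x.1 + x.2.1)
    (hz : ∃ z, x.2.2 = (2 : ℤ) • z) : x ∈ LinearMap.range L.toOddExt := by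
  obtain ⟨s, hs⟩ := h
  obtain ⟨z, hz⟩ := hz
  refine ⟨((s, x.1 - 2 * s), z), ?_⟩
  rw [toOddExt_apply]
  ext
  · simp
  · simp; omega
  · exact hz.symm

theorem even_oddExt_iff {L : IntLat} (he : L.IsEven) (x : ℤ × ℤ × L.V) :
    Even (L.oddExt.B x x) ↔ Even (x.1 + x.2.1) := by
  rw [oddExt_B]
  have := he x.2.2
  simp only [Int.even_add, Int.even_sub, Int.even_mul, or_self] at this ⊢
  tauto

theorem exists_eq_two_smul {L : IntLat} (hd : |L.disc| = 2) {z : L.V} (h1 : ∀ x, 2 ∣ L.B z x)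
    (h2 : 4 ∣ L.B z z) : ∃ y, z = (2 : ℤ) • y := by
  by_cases hz : z = 0
  · exact ⟨0, by simp [hz]⟩
  obtain ⟨g, y, f, rfl, hy⟩ := exists_primitive hz
  rcases Int.even_or_odd' g with ⟨k, rfl | hk⟩
  · exact ⟨k • y, by rw [mul_smul]⟩
  exfalso
  have hg : IsCoprime (2 : ℤ) g := ⟨-k, 1, by rw [hk]; ring⟩
  have h3 : ∀ x, 2 ∣ L.B y x := fun x => by
    have := h1 x
    rw [map_smul, LinearMap.smul_apply, smul_eq_mul] at this
    exact hg.dvd_of_dvd_mul_left this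
  have h4 : (2 : ℤ) ^ 2 ∣ L.B y y := by
    have hg4 : IsCoprime ((2 : ℤ) ^ 2) (g * g) := hg.pow_left.mul_right hg.pow_left
    refine hg4.dvd_of_dvd_mul_left ?_
    simpa [mul_assoc] using h2
  have h5 := L.sq_dvd_disc hy h3 h4
  rw [← dvd_abs, hd] at h5
  norm_num at h5

theorem plane_prod_iso_of_dvd {L M : IntLat} (hL : L.IsEven) (hM : M.IsEven) (hd : |L.disc| = 2)
    (hr : L.rank = M.rank) (hdisc : L.disc = M.disc) (φ : (ℤ × ℤ × L.V) ≃ₗ[ℤ] (ℤ × ℤ × M.V))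
    (hφ : ∀ x y, M.oddExt.B (φ x) (φ y) = L.oddExt.B x y)
    (h4 : 4 ∣ (φ (1, -1, 0)).1 + (φ (1, -1, 0)).2.1)
    (hz : ∃ z, (φ (1, -1, 0)).2.2 = (2 : ℤ) • z) :
    Iso (prod (plane 0) L) (prod (plane 0) M) := by
  have hmem : ∀ x, φ (L.toOddExt x) ∈ LinearMap.range M.toOddExt := by
    rintro ⟨⟨s, t⟩, z⟩
    have hx : L.toOddExt ((s, t), z) = (2 : ℤ) • (s, s, z) + t • (1, -1, 0) := by
      rw [toOddExt_apply]
      ext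
      · simp
      · simp; ring
      · simp
    have he : Even ((φ (s, s, z)).1 + (φ (s, s, z)).2.1) := by
      rw [← even_oddExt_iff hM, hφ, even_oddExt_iff hL]
      exact ⟨s, rfl⟩
    rw [hx, map_add, map_smul, map_smul]
    refine Submodule.add_mem _ ?_
      (Submodule.smul_mem _ _ (M.mem_range_toOddExt h4 hz))
    refine M.mem_range_toOddExt ?_ ⟨_, rfl⟩
    obtain ⟨k, hk⟩ := he
    exact ⟨k, by simp; linarith⟩
  let ψ : (ℤ × ℤ) × L.V →ₗ[ℤ] (ℤ × ℤ) × M.V :=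
    (LinearEquiv.ofInjective M.toOddExt M.toOddExt_injective).symm.toLinearMap ∘ₗ
      (φ.toLinearMap ∘ₗ L.toOddExt).codRestrict _ hmem
  have hψ : ∀ x, M.toOddExt (ψ x) = φ (L.toOddExt x) := fun x =>
    congrArg Subtype.val
      ((LinearEquiv.ofInjective M.toOddExt M.toOddExt_injective).apply_symm_apply
        ⟨φ (L.toOddExt x), hmem x⟩)
  refine Iso.of_embedding ψ (fun x y => ?_) ?_ ?_ ?_
  · have h := hφ (L.toOddExt x) (L.toOddExt y)
    rw [← hψ, ← hψ, toOddExt_B, toOddExt_B] at h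
    exact mul_left_cancel₀ (by norm_num) h
  · rw [rank_prod, rank_prod, hr]
  · rw [disc_prod, disc_prod, hdisc]
  · rw [disc_prod, disc_plane, neg_one_mul, neg_ne_zero]
    rintro h
    simp [h] at hd

/-- Even lattices of discriminant `±2` that become isometric after adding `⟨1⟩ ⊥ ⟨-1⟩` become
isometric after adding a hyperbolic plane. -/
theorem plane_prod_iso_of_oddExt_iso {L M : IntLat} (hL : L.IsEven) (hM : M.IsEven)
    (hd : |L.disc| = 2) (h : Iso L.oddExt M.oddExt) :
    Iso (prod (plane 0) L) (prod (plane 0) M) := by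
  have hr := h.rank_eq
  have hdisc := h.disc_eq
  simp only [rank_prod, add_right_inj] at hr
  simp only [disc_prod, disc_line, one_mul, neg_one_mul, neg_inj] at hdisc
  obtain ⟨φ, hφ⟩ := h
  change (ℤ × ℤ × L.V) ≃ₗ[ℤ] (ℤ × ℤ × M.V) at φ
  set w := φ (1, -1, 0) with hw
  have hww : M.oddExt.B w w = 0 := by
    rw [hw, hφ, oddExt_B]; simp
  have hodd : ∀ u, Even (u.1 + u.2.1) → 2 ∣ M.oddExt.B w u := by
    intro u hu
    have h1 : Even ((φ.symm u).1 + (φ.symm u).2.1) := by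
      rw [← even_oddExt_iff hL, ← hφ, φ.apply_symm_apply, even_oddExt_iff hM]
      exact hu
    rw [← φ.apply_symm_apply u, hw, hφ, oddExt_B]
    simpa using h1.two_dvd
  have hpar : Even (w.1 + w.2.1) := by
    rw [← even_oddExt_iff hM, hww]
    exact Even.zero
  rw [oddExt_B] at hww
  obtain ⟨p, hp⟩ := hpar
  have hprod : M.B w.2.2 w.2.2 = -4 * (p * (p - w.2.1)) := by
    have : w.1 = 2 * p - w.2.1 := by linarith
    rw [this] at hww
    linear_combination hww
  obtain ⟨z, hz⟩ := exists_eq_two_smul (hdisc ▸ hd) (z := w.2.2) (fun x => by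
    have := hodd (0, 0, x) Even.zero
    rw [oddExt_B] at this
    simpa using this) (by rw [hprod]; exact ⟨-(p * (p - w.2.1)), by ring⟩)
  have heven : Even (p * (p - w.2.1)) := by
    obtain ⟨k, hk⟩ := hM z
    rw [hz] at hprod
    simp only [map_smul, LinearMap.smul_apply, smul_eq_mul] at hprod
    exact ⟨-k, by linarith⟩
  rcases Int.even_mul.1 heven with ⟨k, hk⟩ | ⟨k, hk⟩
  · exact plane_prod_iso_of_dvd hL hM hd hr hdisc φ hφ ⟨k, by rw [← hw]; omega⟩ ⟨z, hz⟩
  · let σ : (ℤ × ℤ × M.V) ≃ₗ[ℤ] (ℤ × ℤ × M.V) :=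
      (LinearEquiv.refl ℤ ℤ).prodCongr ((LinearEquiv.neg ℤ).prodCongr (LinearEquiv.refl ℤ M.V))
    have hσ : ∀ x, σ x = (x.1, -x.2.1, x.2.2) := fun x => rfl
    refine plane_prod_iso_of_dvd hL hM hd hr hdisc (φ.trans σ) (fun x y => ?_) ?_ ?_
    · rw [← hφ x y, LinearEquiv.trans_apply, LinearEquiv.trans_apply, hσ, hσ, oddExt_B, oddExt_B]
      ring
    · rw [LinearEquiv.trans_apply, ← hw, hσ]
      exact ⟨k, by simp only; omega⟩
    · rw [LinearEquiv.trans_apply, ← hw, hσ]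
      exact ⟨z, hz⟩

theorem exists_iso_plane_prod (L : IntLat) (he : L.IsEven) (hr : L.rank = 11) (hd : |L.disc| = 2)
    (h2 : L.AtMostTwoPos) (h2' : L.AtLeastTwoPos) :
    ∃ M : IntLat, M.IsEven ∧ |M.disc| = 2 ∧ Iso L (prod (plane 0) M) ∧
      Iso M.oddExt
        (prod (line (-1)) (prod (line (-1)) (prod (line 1) (prod (line 1) (stdNeg 6))))) := by
  have key : ∀ {L M : IntLat}, Iso L (prod (plane 0) M) → |L.disc| = 2 →
      |M.disc| = 2 ∧ L.rank = M.rank + 2 := fun {L M} h hd => by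
    have h1 := h.disc_eq
    have h2 := h.rank_eq
    rw [disc_prod, disc_plane] at h1
    rw [rank_prod, rank_plane] at h2
    exact ⟨by rw [← hd, h1, neg_one_mul, abs_neg], by omega⟩
  obtain ⟨p, hp⟩ := h2'.1
  obtain ⟨x, hx, hxx⟩ := L.exists_isotropic he hd (Or.inl hr) h2 hp
  obtain ⟨M, hM, i1⟩ := L.isotropic_split_even he hd hx hxx
  obtain ⟨hdM, hrM⟩ := key i1 hd
  have hM1 : M.AtMostOnePos := atMostOnePos_of_plane_prod (Or.inl rfl) (i1.atMostTwoPos h2)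
  obtain ⟨q, hq⟩ := exists_pos_of_plane_prod (i1.atLeastTwoPos h2')
  obtain ⟨y, hy, hyy⟩ := M.exists_isotropic hM hdM (Or.inr (by omega)) hM1.atMostTwoPos hq
  obtain ⟨E, hE, i2⟩ := M.isotropic_split_even hM hdM hy hyy
  obtain ⟨hdE, hrE⟩ := key i2 hdM
  have hEneg : E.NegDef := negDef_of_plane_prod (Or.inl rfl) (i2.atMostOnePos hM1)
  refine ⟨M, hM, hdM, i1, ?_⟩
  have i3 := line_prod_iso_stdNeg 6 E le_rfl hEneg (by omega) hdE
  exact (prod_congr_right _ (prod_congr_right _ i2)).trans ((prod_left_comm _ _ _).trans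
    (prod_congr_right _ ((line_prod_plane_prod_iso (Or.inl rfl) (Or.inl rfl) E).trans
      ((prod_left_comm _ _ _).trans (prod_congr_right _ (prod_congr_right _ i3))))))

/-- An even lattice of rank `11` and discriminant `±2` whose form has exactly two positive squares
is unique up to isometry. -/
theorem iso_of_two_pos {L M : IntLat} (hL : L.IsEven) (hM : M.IsEven) (hrL : L.rank = 11)
    (hrM : M.rank = 11) (hdL : |L.disc| = 2) (hdM : |M.disc| = 2) (hL2 : L.AtMostTwoPos)
    (hL2' : L.AtLeastTwoPos) (hM2 : M.AtMostTwoPos) (hM2' : M.AtLeastTwoPos) : Iso L M := by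
  obtain ⟨L₁, h1, h2, h3, h4⟩ := L.exists_iso_plane_prod hL hrL hdL hL2 hL2'
  obtain ⟨M₁, h1', h2', h3', h4'⟩ := M.exists_iso_plane_prod hM hrM hdM hM2 hM2'
  exact h3.trans ((plane_prod_iso_of_oddExt_iso h1 h1' h2 (h4.trans h4'.symm)).trans h3'.symm)

/-- The lattice `ℤⁿ` with a given symmetric Gram matrix. -/
noncomputable def ofMatrix {n : ℕ} (G : Matrix (Fin n) (Fin n) ℤ) (hG : Gᵀ = G) : IntLat where
  V := Fin n → ℤ
  B := Matrix.toLinearMap₂' ℤ G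
  symm x y := by
    rw [Matrix.toLinearMap₂'_apply', Matrix.toLinearMap₂'_apply', dotProduct_mulVec,
      dotProduct_comm, ← mulVec_transpose, hG]

theorem ofMatrix_B {n : ℕ} (G : Matrix (Fin n) (Fin n) ℤ) (hG : Gᵀ = G) (x y : Fin n → ℤ) :
    (ofMatrix G hG).B x y = x ⬝ᵥ G *ᵥ y := Matrix.toLinearMap₂'_apply' G x y

theorem rank_ofMatrix {n : ℕ} (G : Matrix (Fin n) (Fin n) ℤ) (hG : Gᵀ = G) :
    (ofMatrix G hG).rank = n := finrank_fin_fun ℤ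

theorem disc_ofMatrix {n : ℕ} (G : Matrix (Fin n) (Fin n) ℤ) (hG : Gᵀ = G) :
    (ofMatrix G hG).disc = G.det := by
  rw [disc_eq (ofMatrix G hG) (Pi.basisFun ℤ (Fin n))]
  congr 1
  ext i j
  change Matrix.toLinearMap₂' ℤ G (Pi.basisFun ℤ (Fin n) i) (Pi.basisFun ℤ (Fin n) j) = G i j
  simp [Matrix.toLinearMap₂'_apply']

end IntLat

theorem card_discGroup {n : ℕ} (G : Matrix (Fin n) (Fin n) ℤ) (hG : G.det ≠ 0) :
    Nat.card (DiscGroup G) = G.det.natAbs := by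
  have hinj : Function.Injective G.mulVecLin := Matrix.mulVec_injective_of_det_ne_zero hG
  have h := Submodule.natAbs_det_equiv (LinearMap.range G.mulVecLin)
    (LinearEquiv.ofInjective G.mulVecLin hinj)
  rw [← LinearMap.det_toLin' G]
  exact h.symm

/-- A signature `(2, q)` form in real coordinates that diagonalize it. -/
theorem HasSignature.exists_coords {n q : ℕ} {G : Matrix (Fin n) (Fin n) ℤ}
    (h : HasSignature G 2 q) :
    ∃ (A : (Fin n → ℝ) ≃ₗ[ℝ] (Fin n → ℝ)) (d : Fin n → ℝ) (i j : Fin n), i ≠ j ∧ d i = 1 ∧ d j = 1 ∧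
      (∀ k, k ≠ i → k ≠ j → d k = -1) ∧
      ∀ a b, A a ⬝ᵥ G.map (Int.cast : ℤ → ℝ) *ᵥ A b = ∑ k, d k * (a k * b k) := by
  obtain ⟨P, d, hP, hd, h2, -, hPG⟩ := h
  obtain ⟨i, j, hij, hs⟩ := Finset.card_eq_two.1 h2
  have hmem : ∀ k, d k = 1 ↔ k = i ∨ k = j := fun k => by
    have := Finset.ext_iff.1 hs k
    simpa using this
  refine ⟨P.toLinearEquiv' (Matrix.invertibleOfIsUnitDet P hP), d, i, j, hij,
    (hmem i).2 (Or.inl rfl), (hmem j).2 (Or.inr rfl),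
    fun k hi hj => (hd k).resolve_left fun h => ?_, fun a b => ?_⟩
  · exact ((hmem k).1 h).elim hi hj
  · change P *ᵥ a ⬝ᵥ G.map (Int.cast : ℤ → ℝ) *ᵥ (P *ᵥ b) = _
    rw [mulVec_mulVec, ← vecMul_transpose, ← dotProduct_mulVec, mulVec_mulVec, ← Matrix.mul_assoc,
      hPG, dotProduct]
    refine Finset.sum_congr rfl fun k _ => ?_
    rw [mulVec_diagonal]
    ring

theorem sum_signature_le {n : ℕ} {d : Fin n → ℝ} {i j : Fin n}
    (hd : ∀ k, k ≠ i → k ≠ j → d k = -1) {a : Fin n → ℝ} (hi : a i = 0) (hj : a j = 0)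
    (h : 0 ≤ ∑ k, d k * (a k * a k)) : a = 0 := by
  have hk : ∀ k, d k * (a k * a k) = -(a k * a k) := fun k => by
    by_cases h1 : k = i
    · simp [h1, hi]
    by_cases h2 : k = j
    · simp [h2, hj]
    rw [hd k h1 h2]
    ring
  simp only [hk, Finset.sum_neg_distrib] at h
  have h0 : ∑ k, a k * a k = 0 :=
    le_antisymm (by linarith) (Finset.sum_nonneg fun k _ => mul_self_nonneg _)
  funext k
  have := (Finset.sum_eq_zero_iff_of_nonneg fun k _ => mul_self_nonneg (a k)).1 h0 k
    (Finset.mem_univ k)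
  simpa using this

theorem exists_int_pos_of_real {n : ℕ} (R : (Fin n → ℝ) → ℝ) (hc : Continuous R)
    (hR : ∀ (t : ℝ) x, R (t • x) = t ^ 2 * R x) {p : Fin n → ℝ} (hp : 0 < R p) :
    ∃ x : Fin n → ℤ, 0 < R fun i => (x i : ℝ) := by
  obtain ⟨q, hq⟩ := (DenseRange.piMap fun _ : Fin n => Rat.denseRange_cast (𝕜 := ℝ)).exists_mem_open
    (isOpen_lt continuous_const hc) ⟨p, hp⟩
  obtain ⟨N, hN⟩ := IsLocalization.exist_integer_multiples_of_finite (nonZeroDivisors ℤ) q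
  choose x hx using hN
  refine ⟨x, ?_⟩
  have hx' : (fun i => (x i : ℝ)) = ((N : ℤ) : ℝ) • Pi.map (fun _ => Rat.cast) q := by
    funext i
    have := congrArg (Rat.cast : ℚ → ℝ) (hx i)
    simpa using this
  rw [hx', hR]
  have h0 : ((N : ℤ) : ℝ) ≠ 0 := by exact_mod_cast nonZeroDivisors.coe_ne_zero N
  exact mul_pos (by positivity) hq

namespace IntLat

theorem B_reject (L : IntLat) (v x : L.V) : L.B v (L.B v v • x - L.B x v • v) = 0 := by
  rw [map_sub, map_smul, map_smul, L.symm v x, smul_eq_mul, smul_eq_mul, mul_comm, sub_self]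

theorem cast_ofMatrix_B {n : ℕ} (G : Matrix (Fin n) (Fin n) ℤ) (hG : Gᵀ = G) (x y : Fin n → ℤ) :
    (((ofMatrix G hG).B x y : ℤ) : ℝ) =
      (fun i => (x i : ℝ)) ⬝ᵥ G.map (Int.cast : ℤ → ℝ) *ᵥ fun i => (y i : ℝ) := by
  rw [ofMatrix_B]
  simp [dotProduct, mulVec]

theorem atMostTwoPos_ofMatrix {n q : ℕ} {G : Matrix (Fin n) (Fin n) ℤ} (hG : Gᵀ = G)
    (h : HasSignature G 2 q) : (ofMatrix G hG).AtMostTwoPos := by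
  obtain ⟨A, d, i, j, -, -, -, hd, hA⟩ := h.exists_coords
  let c : (Fin n → ℤ) → Fin n → ℝ := fun x => A.symm fun i => (x i : ℝ)
  have hc : ∀ x y : Fin n → ℤ, (((ofMatrix G hG).B x y : ℤ) : ℝ) = ∑ k, d k * (c x k * c y k) :=
    fun x y => by
      rw [cast_ofMatrix_B, ← hA, A.apply_symm_apply, A.apply_symm_apply]
  intro (x : Fin n → ℤ) (y : Fin n → ℤ) (z : Fin n → ℤ) hxy hxz hyz hx hy hz
  have hxy' : (((ofMatrix G hG).B x y : ℤ) : ℝ) = 0 := by rw [hxy, Int.cast_zero]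
  have hxz' : (((ofMatrix G hG).B x z : ℤ) : ℝ) = 0 := by rw [hxz, Int.cast_zero]
  have hyz' : (((ofMatrix G hG).B y z : ℤ) : ℝ) = 0 := by rw [hyz, Int.cast_zero]
  have hx' : 0 < (((ofMatrix G hG).B x x : ℤ) : ℝ) := by exact_mod_cast hx
  have hy' : 0 < (((ofMatrix G hG).B y y : ℤ) : ℝ) := by exact_mod_cast hy
  have hz' : 0 ≤ (((ofMatrix G hG).B z z : ℤ) : ℝ) := by exact_mod_cast hz
  rw [hc] at hxy' hxz' hyz' hx' hy' hz'
  let M : Matrix (Fin 2) (Fin 3) ℝ := !![c x i, c y i, c z i; c x j, c y j, c z j]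
  obtain ⟨r, hr, hr0⟩ := Submodule.exists_mem_ne_zero_of_ne_bot
    (LinearMap.ker_ne_bot_of_finrank_lt (f := M.mulVecLin) (by simp))
  rw [LinearMap.mem_ker, Matrix.mulVecLin_apply] at hr
  have h1 := congrFun hr 0
  have h2 := congrFun hr 1
  simp [M, mulVec, dotProduct, Fin.sum_univ_three] at h1 h2
  set a := r 0 • c x + r 1 • c y + r 2 • c z with ha
  have hsum : ∑ k, d k * (a k * a k) = r 0 ^ 2 * ∑ k, d k * (c x k * c x k) +
      r 1 ^ 2 * ∑ k, d k * (c y k * c y k) + r 2 ^ 2 * ∑ k, d k * (c z k * c z k) := by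
    have : ∑ k, d k * (a k * a k) = r 0 ^ 2 * ∑ k, d k * (c x k * c x k) +
        r 1 ^ 2 * ∑ k, d k * (c y k * c y k) + r 2 ^ 2 * ∑ k, d k * (c z k * c z k) +
        2 * r 0 * r 1 * ∑ k, d k * (c x k * c y k) + 2 * r 0 * r 2 * ∑ k, d k * (c x k * c z k) +
        2 * r 1 * r 2 * ∑ k, d k * (c y k * c z k) := by
      simp only [Finset.mul_sum, ← Finset.sum_add_distrib]
      refine Finset.sum_congr rfl fun k _ => ?_
      simp [ha]; ring
    rw [this, hxy', hxz', hyz']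
    ring
  have ha0 : a = 0 := sum_signature_le hd (by simp [ha]; linarith) (by simp [ha]; linarith)
    (by rw [hsum]; positivity)
  rw [ha0] at hsum
  simp only [Pi.zero_apply, mul_zero, Finset.sum_const_zero] at hsum
  have p0 := mul_nonneg (sq_nonneg (r 0)) hx'.le
  have p1 := mul_nonneg (sq_nonneg (r 1)) hy'.le
  have p2 := mul_nonneg (sq_nonneg (r 2)) hz'
  have r0 : r 0 = 0 := by
    have : r 0 ^ 2 * ∑ k, d k * (c x k * c x k) = 0 := by linarith
    simpa [hx'.ne'] using this
  have r1 : r 1 = 0 := by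
    have : r 1 ^ 2 * ∑ k, d k * (c y k * c y k) = 0 := by linarith
    simpa [hy'.ne'] using this
  have r2 : r 2 ≠ 0 := fun r2 => hr0 (by ext k; fin_cases k <;> simp [r0, r1, r2])
  have hcz : c z = 0 := by
    rw [ha, r0, r1] at ha0
    simpa [r2] using ha0
  have hz0 : (fun i => (z i : ℝ)) = 0 := A.symm.map_eq_zero_iff.1 hcz
  funext k
  have : z k = 0 := by simpa using congrFun hz0 k
  exact this

theorem atLeastTwoPos_ofMatrix {n q : ℕ} {G : Matrix (Fin n) (Fin n) ℤ} (hG : Gᵀ = G)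
    (h : HasSignature G 2 q) : (ofMatrix G hG).AtLeastTwoPos := by
  obtain ⟨A, d, i, j, hij, hi, hj, hd, hA⟩ := h.exists_coords
  let Q : (Fin n → ℝ) →ₗ[ℝ] (Fin n → ℝ) →ₗ[ℝ] ℝ := Matrix.toLinearMap₂' ℝ (G.map (Int.cast : ℤ → ℝ))
  have hQ : ∀ a b, Q (A a) (A b) = ∑ k, d k * (a k * b k) := fun a b => by
    rw [← hA]
    exact Matrix.toLinearMap₂'_apply' _ _ _
  have hQB : ∀ x y : Fin n → ℤ, Q (fun i => (x i : ℝ)) (fun i => (y i : ℝ)) =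
      (((ofMatrix G hG).B x y : ℤ) : ℝ) := fun x y => by
    rw [cast_ofMatrix_B]
    exact Matrix.toLinearMap₂'_apply' _ _ _
  have hcont : ∀ f : (Fin n → ℝ) →ₗ[ℝ] (Fin n → ℝ), Continuous fun x => Q (f x) (f x) := fun f => by
    have hf : Continuous f := f.continuous_of_finiteDimensional
    have : (fun x => Q (f x) (f x)) =
        fun x => f x ⬝ᵥ G.map (Int.cast : ℤ → ℝ) *ᵥ f x :=
      funext fun x => Matrix.toLinearMap₂'_apply' _ _ _
    rw [this]
    exact hf.dotProduct (continuous_const.matrix_mulVec hf)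
  have hhom : ∀ (f : (Fin n → ℝ) →ₗ[ℝ] (Fin n → ℝ)) (t : ℝ) x,
      Q (f (t • x)) (f (t • x)) = t ^ 2 * Q (f x) (f x) := fun f t x => by
    simp only [map_smul, LinearMap.smul_apply, smul_eq_mul]
    ring
  have hcomb : ∀ α β : ℝ, (∀ b, Q (A (α • Pi.single i 1 + β • Pi.single j 1)) (A b) =
      α * b i + β * b j) := fun α β b => by
    rw [hQ]
    simp only [Pi.add_apply, Pi.smul_apply, smul_eq_mul, add_mul, mul_add, Finset.sum_add_distrib]
    simp [Pi.single_apply, hi, hj]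
  refine ⟨?_, fun v hv => ?_⟩
  · obtain ⟨x, hx⟩ := exists_int_pos_of_real (fun x => Q x x) (hcont LinearMap.id)
      (hhom LinearMap.id) (p := A ((1 : ℝ) • Pi.single i 1 + (0 : ℝ) • Pi.single j 1))
      (by rw [hcomb]; simp [hij])
    exact ⟨x, by rw [hQB] at hx; exact_mod_cast hx⟩
  · change Fin n → ℤ at v
    set m := (ofMatrix G hG).B v v with hm
    let v' : Fin n → ℝ := fun i => (v i : ℝ)
    have hv' : Q v' v' = (m : ℝ) := hQB v v
    let f : (Fin n → ℝ) →ₗ[ℝ] (Fin n → ℝ) :=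
      (m : ℝ) • LinearMap.id - (Q.flip v').smulRight v'
    have hf : ∀ x, f x = (m : ℝ) • x - Q x v' • v' := fun x => rfl
    obtain ⟨α, β, h0, hne⟩ : ∃ α β : ℝ, α * A.symm v' i + β * A.symm v' j = 0 ∧
        0 < α ^ 2 + β ^ 2 := by
      by_cases h : A.symm v' i = 0
      · exact ⟨1, 0, by simp [h], by norm_num⟩
      · exact ⟨-A.symm v' j, A.symm v' i, by ring, by positivity⟩
    set p := A (α • Pi.single i 1 + β • Pi.single j 1) with hp
    have hpv : Q p v' = 0 := by
      rw [← A.apply_symm_apply v', hp, hcomb, h0]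
    have hpp : Q p p = α ^ 2 + β ^ 2 := by
      rw [hp, hcomb]
      simp [hij, hij.symm]; ring
    have hm0 : (0 : ℝ) < m := by exact_mod_cast hv
    have hfp : f p = (m : ℝ) • p := by rw [hf, hpv, zero_smul, sub_zero]
    obtain ⟨x, hx⟩ := exists_int_pos_of_real (fun x => Q (f x) (f x)) (hcont f) (hhom f) (p := p)
      (by
        simp only [hfp, map_smul, LinearMap.smul_apply, smul_eq_mul, hpp]
        positivity)
    have hfx : f (fun i => (x i : ℝ)) =
        fun i => ((m • x - (ofMatrix G hG).B x v • v) i : ℝ) := by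
      rw [hf, hQB]
      funext k
      simp [v']
    refine ⟨m • x - (ofMatrix G hG).B x v • v, ?_, ?_⟩
    · exact (ofMatrix G hG).B_reject v x
    · rw [hfx, hQB] at hx
      exact_mod_cast hx

end IntLat

theorem HasSignature.of_diagonal {n p q : ℕ} {G P : Matrix (Fin n) (Fin n) ℤ} {D : Fin n → ℤ}
    (hP : Pᵀ * G * P = diagonal D) (hD : ∀ i, D i ≠ 0)
    (hp : (Finset.univ.filter fun i => 0 < D i).card = p)
    (hq : (Finset.univ.filter fun i => D i < 0).card = q) : HasSignature G p q := by
  have hdet : P.det ≠ 0 := fun h => by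
    have := congrArg det hP
    rw [det_mul, h, mul_zero, det_diagonal] at this
    exact Finset.prod_ne_zero_iff.2 (fun i _ => hD i) this.symm
  have hs : ∀ i, (0 : ℝ) < √|(D i : ℝ)| := fun i =>
    Real.sqrt_pos.2 (abs_pos.2 (Int.cast_ne_zero.2 (hD i)))
  have hs2 : ∀ i, √|(D i : ℝ)| * √|(D i : ℝ)| = |(D i : ℝ)| := fun i =>
    Real.mul_self_sqrt (abs_nonneg _)
  have hcast : (P.map (Int.cast : ℤ → ℝ))ᵀ * G.map (Int.cast : ℤ → ℝ) * P.map (Int.cast : ℤ → ℝ) =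
      diagonal fun i => (D i : ℝ) := by
    have := congrArg (fun M => M.map (Int.castRingHom ℝ)) hP
    simp only [Matrix.map_mul, diagonal_map (map_zero _)] at this
    exact this
  have hpos : ∀ i, (SignType.sign (D i) : ℝ) = 1 ↔ 0 < D i := fun i => by
    rcases lt_trichotomy (D i) 0 with h | h | h
    · norm_num [sign_neg h, h.le]
    · exact absurd h (hD i)
    · simp [sign_pos h, h]
  have hneg : ∀ i, (SignType.sign (D i) : ℝ) = -1 ↔ D i < 0 := fun i => by
    rcases lt_trichotomy (D i) 0 with h | h | h
    · simp [sign_neg h, h]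
    · exact absurd h (hD i)
    · norm_num [sign_pos h, h.le]
  refine ⟨P.map (Int.cast : ℤ → ℝ) * diagonal fun i => (√|(D i : ℝ)|)⁻¹,
    fun i => (SignType.sign (D i) : ℝ), ?_, fun i => ?_, by simpa only [hpos] using hp,
    by simpa only [hneg] using hq, ?_⟩
  · rw [det_mul, det_diagonal, isUnit_iff_ne_zero]
    refine mul_ne_zero ?_ (Finset.prod_ne_zero_iff.2 fun i _ => inv_ne_zero (hs i).ne')
    have : (P.map (Int.cast : ℤ → ℝ)).det = (P.det : ℝ) := ((Int.castRingHom ℝ).map_det P).symm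
    rw [this]
    exact_mod_cast hdet
  · exact ((hD i).lt_or_gt).elim (fun h => Or.inr ((hneg i).2 h)) fun h => Or.inl ((hpos i).2 h)
  · rw [transpose_mul, diagonal_transpose, Matrix.mul_assoc, Matrix.mul_assoc,
      ← Matrix.mul_assoc (G.map _), ← Matrix.mul_assoc (P.map _)ᵀ, ← Matrix.mul_assoc (P.map _)ᵀ,
      hcast, diagonal_mul_diagonal, diagonal_mul_diagonal]
    congr 1
    funext i
    have hab : (D i : ℝ) = SignType.sign (D i) * |(D i : ℝ)| := by
      rcases (hD i).lt_or_gt with h | h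
      · have : (D i : ℝ) < 0 := by exact_mod_cast h
        simp [sign_neg h, abs_of_neg this]
      · have : (0 : ℝ) < D i := by exact_mod_cast h
        simp [sign_pos h, abs_of_pos this]
    have h := (hs i).ne'
    rw [inv_mul_eq_div, div_eq_iff h, ← div_eq_mul_inv, div_eq_iff h, mul_assoc, hs2]
    exact hab

theorem even_dotProduct_mulVec_self {n : ℕ} {G T : Matrix (Fin n) (Fin n) ℤ} (h : G = T + Tᵀ)
    (x : Fin n → ℤ) : Even (x ⬝ᵥ G *ᵥ x) := by
  refine ⟨x ⬝ᵥ T *ᵥ x, ?_⟩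
  rw [h, add_mulVec, dotProduct_add, mulVec_transpose, dotProduct_comm x (x ᵥ* T),
    ← dotProduct_mulVec]

theorem det_dsum {m k : ℕ} (A : Matrix (Fin m) (Fin m) ℤ) (B : Matrix (Fin k) (Fin k) ℤ) :
    (dsum A B).det = A.det * B.det := by
  rw [dsum, det_reindex_self, det_fromBlocks_zero₂₁]

/-- The columns of this matrix are orthogonal for the form `E8M`. -/
def orthE8 : Matrix (Fin 8) (Fin 8) ℤ :=
  !![1, 0, 1, 2, 2, 2, 2, 2;
     0, 1, 0, 3, 3, 3, 3, 3;
     0, 0, 2, 4, 4, 4, 4, 4;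
     0, 0, 0, 6, 6, 6, 6, 6;
     0, 0, 0, 0, 5, 5, 5, 5;
     0, 0, 0, 0, 0, 4, 4, 4;
     0, 0, 0, 0, 0, 0, 3, 3;
     0, 0, 0, 0, 0, 0, 0, 2]

theorem det_orthE8 : orthE8.det = 1440 := by
  have h : ∀ p : Fin 8 × Fin 8, p.2 < p.1 → orthE8 p.1 p.2 = 0 := by decide +kernel
  rw [det_of_isUpperTriangular fun i j => h (i, j)]
  decide +kernel

theorem det_E8M : E8M.det = 1 := by
  have h : orthE8ᵀ * E8M * orthE8 = diagonal ![2, 2, 6, 30, 20, 12, 6, 2] := by decide +kernel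
  have := congrArg det h
  rw [det_mul, det_mul, det_transpose, det_orthE8, det_diagonal] at this
  simp [Fin.prod_univ_succ] at this
  linarith

theorem det_M12 : M12.det = -2 := by
  rw [M12, det_dsum, det_dsum, det_neg, det_E8M]
  simp [UM, det_fin_two]

theorem M12_transpose : M12ᵀ = M12 := by decide +kernel

theorem even_M12 (x : Fin 11 → ℤ) : Even (x ⬝ᵥ M12 *ᵥ x) :=
  even_dotProduct_mulVec_self
    (T := of fun i j => if i < j then M12 i j else if i = j then M12 i j / 2 else 0)
    (by decide +kernel) x

theorem hasSignature_M12 : HasSignature M12 2 9 :=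
  HasSignature.of_diagonal (P := dsum (dsum !![1] !![1, 1; 1, -1]) orthE8)
    (D := ![2, 2, -2, -2, -2, -6, -30, -20, -12, -6, -2])
    (by decide +kernel) (by decide) (by decide) (by decide)

theorem card_discGroup_M12 : Nat.card (DiscGroup M12) = 2 := by
  rw [card_discGroup M12 (by rw [det_M12]; decide), det_M12]
  rfl

theorem isAddCyclic_discGroup_M12 : IsAddCyclic (DiscGroup M12) :=
  isAddCyclic_of_prime_card (p := 2) card_discGroup_M12

/-- `M = ⟨2⟩ ⊥ U ⊥ E₈(−1)` is an even lattice of rank 11, signature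
`(2, 9)` and discriminant `−2`, whose discriminant group is cyclic of order 2, and
every even lattice `L` of signature `(2, 9)` admitting a group isomorphism
`A(L) → A(M)` preserving the discriminant quadratic forms is isometric to `M`. -/
theorem two_hyperbolic_E8neg_unique_in_genus :
    (∀ x : Fin 11 → ℤ, Even (x ⬝ᵥ M12.mulVec x)) ∧
    HasSignature M12 2 9 ∧
    M12.det = -2 ∧
    (IsAddCyclic (DiscGroup M12) ∧ Nat.card (DiscGroup M12) = 2) ∧
    (∀ L : Matrix (Fin 11) (Fin 11) ℤ,
      L.transpose = L →
      L.det ≠ 0 →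
      (∀ x : Fin 11 → ℤ, Even (x ⬝ᵥ L.mulVec x)) →
      HasSignature L 2 9 →
      (∃ φ : DiscGroup L ≃+ DiscGroup M12,
        ∀ (u : Fin 11 → ℤ) (u' : Fin 11 → ℤ),
          φ (discMk L u) = discMk M12 u' → discQuad M12 u' = discQuad L u) →
      ∃ e : (Fin 11 → ℤ) ≃ₗ[ℤ] (Fin 11 → ℤ), ∀ x y : Fin 11 → ℤ,
        x ⬝ᵥ L.mulVec y = (e x) ⬝ᵥ M12.mulVec (e y)) := by
  refine ⟨even_M12, hasSignature_M12, det_M12, ⟨isAddCyclic_discGroup_M12, card_discGroup_M12⟩, ?_⟩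
  rintro L hLt hL0 hLe hLs ⟨φ, -⟩
  have hdL : |L.det| = 2 := by
    have := card_discGroup L hL0
    rw [Nat.card_congr φ.toEquiv, card_discGroup_M12] at this
    rw [Int.abs_eq_natAbs, ← this]
    rfl
  obtain ⟨e, he⟩ := IntLat.iso_of_two_pos (L := IntLat.ofMatrix L hLt)
    (M := IntLat.ofMatrix M12 M12_transpose)
    (fun x => (IntLat.ofMatrix_B L hLt x x).symm ▸ hLe x)
    (fun x => (IntLat.ofMatrix_B M12 M12_transpose x x).symm ▸ even_M12 x)
    (IntLat.rank_ofMatrix _ _) (IntLat.rank_ofMatrix _ _)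
    (by rw [IntLat.disc_ofMatrix, hdL]) (by rw [IntLat.disc_ofMatrix, det_M12]; rfl)
    (IntLat.atMostTwoPos_ofMatrix hLt hLs) (IntLat.atLeastTwoPos_ofMatrix hLt hLs)
    (IntLat.atMostTwoPos_ofMatrix M12_transpose hasSignature_M12)
    (IntLat.atLeastTwoPos_ofMatrix M12_transpose hasSignature_M12)
  exact ⟨e, fun x y => (IntLat.ofMatrix_B L hLt x y).symm.trans
    ((he x y).symm.trans (IntLat.ofMatrix_B M12 M12_transpose (e x) (e y)))⟩
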